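/- Let n = 3. A glueing datum of dimension n consists of: a finite nonempty index set I (indexing copies Δ_i of the standard n-simplex, realized as {x : {0,…,n} → [0,∞) | Σ_v x_v = 1}, with vertices labeled 0,…,n); a fixed-point-free involution P of the set I × {0,…,n} of codimension-1 faces, where (i,k) denotes the face {x ∈ Δ_i | x_k = 0}; and, for each face (i,k) with P(i,k) = (j,l), a bijection φ_{(i,k)} : {0,…,n}∖{k} → {0,…,n}∖{l}, subject to φ_{(j,l)} = φ_{(i,k)}⁻¹. Let X be the quotient of the disjoint union of the Δ_i by the identifications which, for each (i,k) with P(i,k) = (j,l), identify each point x of the face (i,k) with the point y of the face (j,l) given by y_{φ_{(i,k)}(a)} = x_a for a ≠ k and y_l = 0, endowed with the quotient topology, and let X* be X with the images of the vertices of all the Δ_i removed. Then X* is a topological 3-manifold (i.e., every point of X* has an open neighborhood homeomorphic to ℝ³) if and only if condition Dir holds: there exist relations o_i on {0,…,3} (one for each i ∈ I) such that for all a ≠ b exactly one of o_i(a,b), o_i(b,a) holds, and for every face (i,k) with P(i,k) = (j,l) and all a,b ∈ {0,…,3}∖{k} with a ≠ b one has o_i(a,b) ↔ o_j(φ_{(i,k)}(a),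 φ_{(i,k)}(b)). -/

import Mathlib

open scoped Classical

noncomputable section

/-- A glueing datum of dimension `n`: a finite nonempty set `I` indexing copies of the
standard `n`-simplex, a fixed-point-free involution `P` of the set `I × Fin (n+1)` of
codimension-1 faces (the face `(i,k)` of the `i`-th simplex being opposite to the vertex
`k`), and for each face `(i,k)` with `P (i,k) = (j,l)` a simplicial identification,
encoded as a permutation `glue (i,k)` of the vertex labels sending `k` to `l` (its
restriction to `{0,…,n} \ {k}` is the bijection `φ_{(i,k)}` onto `{0,…,n} \ {l}`),
subject to `φ_{P f} = (φ f)⁻¹`. -/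
structure GlueingDatum (n : ℕ) where
  I : Type
  fintypeI : Fintype I
  nonemptyI : Nonempty I
  P : I × Fin (n + 1) → I × Fin (n + 1)
  P_involutive : ∀ f, P (P f) = f
  P_fixedPointFree : ∀ f, P f ≠ f
  glue : I × Fin (n + 1) → Equiv.Perm (Fin (n + 1))
  glue_face : ∀ f, glue f f.2 = (P f).2
  glue_symm : ∀ f, glue (P f) = (glue f).symm

/-- The permutation of `Fin n` obtained from a permutation `e` of `Fin (n+1)` by
deleting `k` from the source and `e k` from the target, conjugating by the
order-preserving bijections `{0,…,n} \ {k} ≃ {1,…,n}` and `{0,…,n} \ {e k} ≃ {1,…,n}`. -/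
def restrictPerm {n : ℕ} (e : Equiv.Perm (Fin (n + 1))) (k : Fin (n + 1)) :
    Equiv.Perm (Fin n) :=
  (finSuccAboveEquiv k).trans
    ((e.subtypeEquiv (fun _ => (not_congr e.apply_eq_iff_eq).symm)).trans
      (finSuccAboveEquiv (e k)).symm)

/-- The signature of the face-pairing `e` at the face opposite to `k`. -/
def glueSign {n : ℕ} (e : Equiv.Perm (Fin (n + 1))) (k : Fin (n + 1)) : ℤˣ :=
  Equiv.Perm.sign (restrictPerm e k)

/-- Condition Ori: the simplices can be given signs so that every face-pairing
reverses the induced orientation. -/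
def Ori {n : ℕ} (D : GlueingDatum n) : Prop :=
  ∃ ε : D.I → ℤˣ, ∀ (i : D.I) (k : Fin (n + 1)),
    ε i * (-1) ^ (k : ℕ) * glueSign (D.glue (i, k)) k
      = -(ε (D.P (i, k)).1 * (-1) ^ (((D.P (i, k)).2 : Fin (n + 1)) : ℕ))

/-- Condition Dir: the edges of the simplices can be directed compatibly with all the
face-pairings. -/
def Dir {n : ℕ} (D : GlueingDatum n) : Prop :=
  ∃ o : D.I → Fin (n + 1) → Fin (n + 1) → Prop,
    (∀ i a b, a ≠ b → Xor' (o i a b) (o i b a)) ∧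
    (∀ (i : D.I) (k a b : Fin (n + 1)), a ≠ k → b ≠ k → a ≠ b →
      (o i a b ↔ o (D.P (i, k)).1 (D.glue (i, k) a) (D.glue (i, k) b)))

/-- The standard `n`-simplex, in barycentric coordinates. -/
abbrev Delta (n : ℕ) : Type :=
  {x : Fin (n + 1) → ℝ // (∀ v, 0 ≤ x v) ∧ ∑ v, x v = 1}

/-- The disjoint union of the simplices `Δ_i`, `i ∈ I`. -/
abbrev GlueTotal {n : ℕ} (D : GlueingDatum n) : Type := Σ _ : D.I, Delta n

/-- The identifications: for each face `(i,k)` with `P (i,k) = (j,l)`, every point `x`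
of the face `(i,k)` (i.e. with `x k = 0`) is identified with the point `y = x ∘ φ⁻¹` of
the face `(j,l)`, which satisfies `y (φ a) = x a` for `a ≠ k` and `y l = 0`. -/
def glueRel {n : ℕ} (D : GlueingDatum n) : GlueTotal D → GlueTotal D → Prop :=
  fun p q => ∃ k : Fin (n + 1), p.2.1 k = 0 ∧ (D.P (p.1, k)).1 = q.1 ∧
    (q.2.1 : Fin (n + 1) → ℝ) = p.2.1 ∘ ⇑(D.glue (p.1, k)).symm

/-- The glued space `X = S/P`, with the quotient topology. -/
abbrev GlueSpace {n : ℕ} (D : GlueingDatum n) : Type := Quot (glueRel D)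

/-- The image in `X` of the vertices of the simplices. -/
def vertexImage {n : ℕ} (D : GlueingDatum n) : Set (GlueSpace D) :=
  {z | ∃ p : GlueTotal D, (∃ v, p.2.1 v = 1) ∧ Quot.mk (glueRel D) p = z}

/-- The space `X* = X ∖ {vertices}`, with the subspace topology. -/
abbrev GlueSpaceStar {n : ℕ} (D : GlueingDatum n) : Type := ↥((vertexImage D)ᶜ)

/-- Local euclideanness: every point has an open neighborhood homeomorphic to `ℝⁿ`. -/
def LocEuclidean (n : ℕ) (Z : Type) [TopologicalSpace Z] : Prop :=
  ∀ z : Z, ∃ U : Set Z, IsOpen U ∧ z ∈ U ∧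
    Nonempty (↥U ≃ₜ EuclideanSpace ℝ (Fin n))

open scoped Topology

abbrev E3 := EuclideanSpace ℝ (Fin 3)

/-- Complement of a closed ray (`ε = 1` or `ε = -1`). -/
def rayCompl (ε : ℝ) : Set E3 := {w | ε * w 0 < 0 ∨ w 1 ≠ 0 ∨ w 2 ≠ 0}

lemma rayCompl_open (ε : ℝ) : IsOpen (rayCompl ε) := by
  have h0 : IsOpen {w : E3 | ε * w 0 < 0} := isOpen_lt (by fun_prop) (by fun_prop)
  have h1 : IsOpen {w : E3 | w 1 ≠ 0} := isOpen_ne_fun (by fun_prop) (by fun_prop)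
  have h2 : IsOpen {w : E3 | w 2 ≠ 0} := isOpen_ne_fun (by fun_prop) (by fun_prop)
  have h3 : rayCompl ε = {w : E3 | ε * w 0 < 0} ∪ ({w : E3 | w 1 ≠ 0} ∪ {w : E3 | w 2 ≠ 0}) := by
    ext w; rfl
  rw [h3]; exact h0.union (h1.union h2)

lemma rayCompl_star (ε : ℝ) (hε : ε * ε = 1) : StarConvex ℝ (!₂[-ε, 0, 0] : E3) (rayCompl ε) := by
  intro w hw a b ha hb hab
  simp only [rayCompl, Set.mem_ofPred_eq] at hw ⊢
  simp
  rcases eq_or_lt_of_le hb with rfl | hb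
  · left
    have : a = 1 := by linarith
    subst this; nlinarith
  · rcases hw with h | h | h
    · left; nlinarith [mul_pos_of_neg_of_neg h (neg_lt_zero.2 hb)]
    · right; left; exact ⟨hb.ne', h⟩
    · right; right; exact ⟨hb.ne', h⟩

lemma rayCompl_sc (ε : ℝ) (hε : ε * ε = 1) : SimplyConnectedSpace (rayCompl ε) := by
  have : ContractibleSpace (rayCompl ε) := (rayCompl_star ε hε).contractibleSpace
    ⟨!₂[-ε, 0, 0], by simp [rayCompl]; nlinarith⟩
  infer_instance

lemma lineCompl_conn : IsPreconnected {w : E3 | w 1 ≠ 0 ∨ w 2 ≠ 0} := by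
  have h := isConnected_compl_of_one_lt_codim (F := E3) (E := ℝ ∙ (!₂[1, 0, 0] : E3)) (by
    have h1 := Submodule.finrank_quotient_add_finrank (ℝ ∙ (!₂[1, 0, 0] : E3))
    rw [finrank_span_singleton (by intro h; have := congrArg (fun v : E3 => v 0) h; simp at this)] at h1
    rw [finrank_euclideanSpace_fin] at h1
    rw [← Module.finrank_eq_rank]
    norm_cast
    change _ + 1 = 3 at h1
    have h2 : Module.finrank ℝ (E3 ⧸ ℝ ∙ (!₂[1, 0, 0] : E3)) + 1 = 3 := h1
    omega)
  convert h.isPreconnected using 1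
  ext w
  simp only [Set.mem_ofPred_eq, Set.mem_compl_iff, SetLike.mem_coe, Submodule.mem_span_singleton]
  constructor
  · rintro h ⟨a, rfl⟩
    simp at h
  · intro h
    by_contra hc
    push Not at hc
    apply h
    refine ⟨w 0, ?_⟩
    ext i
    fin_cases i <;> simp [hc.1, hc.2]

lemma eq_zero_of_eq_neg' {E : Type*} [AddCommGroup E] [Module ℝ E] {u : E} (h : u = -u) : u = 0 := by
  have h2 : (2:ℝ) • u = 0 := by rw [two_smul]; nth_rewrite 1 [h]; simp
  simpa using h2

/-- There is no antipodal double cover of `ℝ³ ∖ 0` in this sense. -/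
theorem no_antipodal {E : Type*} [NormedAddCommGroup E] [NormedSpace ℝ E]
    (hrk : 1 < Module.rank ℝ E) (V : Set E) (hVo : IsOpen V) (h0V : (0:E) ∈ V)
    (hneg : ∀ u ∈ V, -u ∈ V) (q : E → E3) (hq : ContinuousOn q V)
    (hqo : ∀ O ⊆ V, IsOpen O → IsOpen (q '' O)) (hsurj : ∀ w, ∃ u ∈ V, q u = w)
    (hq0 : q 0 = 0) (hfib : ∀ u ∈ V, ∀ v ∈ V, q u = q v ↔ (u = v ∨ u = -v)) : False := by
  let E0 := {u : E // u ∈ V ∧ u ≠ 0}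
  let H0 := {w : E3 // w ≠ 0}
  have hE0o : IsOpen {u : E | u ∈ V ∧ u ≠ 0} := hVo.inter isOpen_ne
  have hq0' : ∀ u ∈ V, u ≠ 0 → q u ≠ 0 := by
    intro u hu hu0 h
    rw [← hq0, hfib u hu 0 h0V] at h
    simp at h; exact hu0 h
  let p : E0 → H0 := fun u => ⟨q u.1, hq0' u.1 u.2.1 u.2.2⟩
  have hpc : Continuous p := by
    apply Continuous.subtype_mk
    exact hq.comp_continuous continuous_subtype_val (fun u => u.2.1)
  have hps : Function.Surjective p := by
    rintro ⟨w, hw⟩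
    obtain ⟨u, hu, rfl⟩ := hsurj w
    exact ⟨⟨u, hu, fun h => hw (by rw [h, hq0])⟩, rfl⟩
  have hpo : IsOpenMap p := by
    intro O hO
    have h1 : IsOpen (Subtype.val '' O : Set E) := hE0o.isOpenMap_subtype_val O hO
    have h2 := hqo _ (by rintro _ ⟨u, -, rfl⟩; exact u.2.1) h1
    have h3 : p '' O = Subtype.val ⁻¹' (q '' (Subtype.val '' O)) := by
      ext w
      constructor
      · rintro ⟨u, hu, rfl⟩; exact ⟨u.1, ⟨u, hu, rfl⟩, rfl⟩
      · rintro ⟨_, ⟨u, hu, rfl⟩, h⟩; exact ⟨u, hu, Subtype.ext h⟩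
    rw [h3]; exact h2.preimage continuous_subtype_val
  let ng : E0 → E0 := fun u => ⟨-u.1, hneg _ u.2.1, neg_ne_zero.2 u.2.2⟩
  have hngc : Continuous ng := by
    apply Continuous.subtype_mk; fun_prop
  have hpng : ∀ u, p (ng u) = p u := by
    intro u
    apply Subtype.ext
    exact (hfib _ (ng u).2.1 _ u.2.1).2 (Or.inr rfl)
  have hpf : ∀ u v, p u = p v → u = v ∨ u = ng v := by
    intro u v h
    rcases (hfib _ u.2.1 _ v.2.1).1 (congrArg Subtype.val h) with h | h
    · left; exact Subtype.ext h
    · right; exact Subtype.ext h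
  let act : MulAction ℤˣ E0 :=
    { smul := fun ε u => if ε = 1 then u else ng u
      one_smul := fun u => if_pos rfl
      mul_smul := by
        intro a b u
        change (if a * b = 1 then u else ng u) = if a = 1 then (if b = 1 then u else ng u)
          else ng (if b = 1 then u else ng u)
        rcases Int.units_eq_one_or a with rfl | rfl <;> rcases Int.units_eq_one_or b with rfl | rfl <;>
          simp [ng] }
  have hm1 : ∀ u : E0, (-1 : ℤˣ) • u = ng u := fun u => if_neg (by decide)
  have hcov : IsQuotientCoveringMap p ℤˣ := by
    refine { toIsQuotientMap := hpo.isQuotientMap hpc hps, continuous_const_smul := ?_, apply_eq_iff_mem_orbit := ?_, disjoint := ?_ }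
    · intro ε
      rcases Int.units_eq_one_or ε with rfl | rfl
      · simpa using continuous_id'
      · simpa [hm1] using hngc
    · intro u v
      constructor
      · intro h
        rcases hpf u v h with rfl | rfl
        · exact MulAction.mem_orbit_self _
        · exact ⟨-1, hm1 v⟩
      · rintro ⟨ε, rfl⟩
        rcases Int.units_eq_one_or ε with rfl | rfl
        · simp
        · simp [hm1, hpng]
    · intro u
      have hne : u.1 ≠ -u.1 := by
        intro h; exact u.2.2 (eq_zero_of_eq_neg' h)
      obtain ⟨N, M, hN, hM, huN, huM, hd⟩ := t2_separation hne
      refine ⟨{v : E0 | v.1 ∈ N ∧ -v.1 ∈ M}, ?_, ?_⟩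
      · refine IsOpen.mem_nhds ?_ (show u.1 ∈ N ∧ -u.1 ∈ M from ⟨huN, huM⟩)
        exact (hN.preimage continuous_subtype_val).inter (hM.preimage (by fun_prop))
      · intro ε hε
        rcases Int.units_eq_one_or ε with rfl | rfl
        · rfl
        · exfalso
          obtain ⟨x, ⟨v, hv, hx⟩, hx2⟩ := hε
          have : x.1 = -v.1 := by rw [← hx]; simp only [hm1]; rfl
          have h1 : x.1 ∈ N := hx2.1
          rw [this] at h1
          exact Set.disjoint_left.1 hd h1 hv.2
  have cov : IsCoveringMap p := hcov.isCoveringMap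
  -- base point
  let w0 : E3 := !₂[0, 1, 0]
  have hw0 : ∀ ε, w0 ∈ rayCompl ε := by intro ε; simp [rayCompl, w0]
  have hw00 : w0 ≠ 0 := by
    intro h; have := congrArg (fun v : E3 => v 1) h; simp [w0] at this
  obtain ⟨e0, he0⟩ := hps ⟨w0, hw00⟩
  have hray0 : ∀ ε, ∀ w ∈ rayCompl ε, w ≠ 0 := by
    rintro ε w hw rfl; simp [rayCompl] at hw
  let inc : ∀ ε, C(rayCompl ε, H0) := fun ε => ⟨fun w => ⟨w.1, hray0 ε _ w.2⟩, by fun_prop⟩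
  have lift : ∀ ε : ℝ, ε * ε = 1 → ∃ F : C(rayCompl ε, E0), F ⟨w0, hw0 ε⟩ = e0 ∧ p ∘ F = inc ε := by
    intro ε hε
    have := rayCompl_sc ε hε
    have := (rayCompl_open ε).locallyPathConnectedSpace
    exact (cov.existsUnique_continuousMap_lifts (inc ε) ⟨w0, hw0 ε⟩ e0 he0).exists
  obtain ⟨F, hF0, hF⟩ := lift 1 (by norm_num)
  obtain ⟨G, hG0, hG⟩ := lift (-1) (by norm_num)
  have hcover : ∀ w : E3, w ≠ 0 → w ∉ rayCompl 1 → w ∈ rayCompl (-1) := by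
    intro w hw h1
    simp only [rayCompl, Set.mem_ofPred_eq] at h1 ⊢
    push Not at h1
    left
    have : w 0 ≠ 0 := by
      intro h; apply hw; ext i; fin_cases i <;> simp [h, h1.2.1, h1.2.2]
    have := lt_of_le_of_ne (by simpa using h1.1) this.symm
    linarith
  have hFG : ∀ w (h1 : w ∈ rayCompl 1) (h2 : w ∈ rayCompl (-1)), F ⟨w, h1⟩ = G ⟨w, h2⟩ := by
    have hsub : ∀ ε, ∀ w : E3, (w 1 ≠ 0 ∨ w 2 ≠ 0) → w ∈ rayCompl ε := fun ε w h => Or.inr h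
    have : PreconnectedSpace {w : E3 | w 1 ≠ 0 ∨ w 2 ≠ 0} := Subtype.preconnectedSpace lineCompl_conn
    have key := cov.eq_of_comp_eq (A := {w : E3 | w 1 ≠ 0 ∨ w 2 ≠ 0})
      (g₁ := fun w => F ⟨w.1, hsub 1 _ w.2⟩) (g₂ := fun w => G ⟨w.1, hsub _ _ w.2⟩)
      (by fun_prop) (by fun_prop)
      (by
        funext w
        exact (congrFun hF ⟨w.1, hsub 1 _ w.2⟩).trans (congrFun hG ⟨w.1, hsub (-1) _ w.2⟩).symm)
      ⟨w0, by simp [w0]⟩ (hF0.trans hG0.symm)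
    intro w h1 h2
    have hw : w 1 ≠ 0 ∨ w 2 ≠ 0 := by
      rcases h1 with h | h
      · rcases h2 with h' | h'
        · linarith
        · exact h'
      · exact h
    exact congrFun key ⟨w, hw⟩
  let σ : H0 → E0 := fun w => if h : w.1 ∈ rayCompl 1 then F ⟨w.1, h⟩ else G ⟨w.1, hcover _ w.2 h⟩
  have hσF : ∀ w (h : w.1 ∈ rayCompl 1), σ w = F ⟨w.1, h⟩ := fun w h => dif_pos h
  have hσG : ∀ w (h : w.1 ∈ rayCompl (-1)), σ w = G ⟨w.1, h⟩ := by
    intro w h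
    by_cases h1 : w.1 ∈ rayCompl 1
    · rw [hσF w h1, hFG]
    · exact dif_neg h1
  have hpσ : ∀ w, p (σ w) = w := by
    intro w
    by_cases h1 : w.1 ∈ rayCompl 1
    · rw [hσF w h1]; exact congrFun hF ⟨w.1, h1⟩
    · rw [hσG w (hcover _ w.2 h1)]; exact congrFun hG ⟨w.1, _⟩
  have hσc : Continuous σ := by
    have aux : ∀ (ε : ℝ) (K : C(rayCompl ε, E0)), (∀ w (h : w.1 ∈ rayCompl ε), σ w = K ⟨w.1, h⟩) →
        ∀ w : H0, w.1 ∈ rayCompl ε → ContinuousAt σ w := by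
      intro ε K hK w hw
      have hO : IsOpen {w : H0 | w.1 ∈ rayCompl ε} := (rayCompl_open ε).preimage continuous_subtype_val
      have : ContinuousOn σ {w : H0 | w.1 ∈ rayCompl ε} := by
        rw [continuousOn_iff_continuous_domRestrict]
        have : Set.domRestrict {w : H0 | w.1 ∈ rayCompl ε} σ = fun w : {w : H0 | w.1 ∈ rayCompl ε} => K ⟨w.1.1, w.2⟩ := by
          funext w; exact hK w.1 w.2
        rw [this]
        exact K.continuous.comp (Continuous.subtype_mk (continuous_subtype_val.comp continuous_subtype_val) _)
      exact this.continuousAt (hO.mem_nhds hw)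
    rw [continuous_iff_continuousAt]
    intro w
    by_cases h1 : w.1 ∈ rayCompl 1
    · exact aux 1 F hσF w h1
    · exact aux (-1) G hσG w (hcover _ w.2 h1)
  obtain ⟨δ, hδ, hball⟩ := Metric.isOpen_iff.1 hVo 0 h0V
  have hS : ∀ u ∈ Metric.sphere (0:E) (δ/2), u ∈ V ∧ u ≠ 0 := by
    intro u hu
    rw [mem_sphere_zero_iff_norm] at hu
    refine ⟨hball (by rw [mem_ball_zero_iff]; linarith), ?_⟩
    rintro rfl; simp at hu; linarith
  have hSc := isConnected_sphere hrk (0:E) (half_pos hδ).le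
  let S : Set E0 := Subtype.val ⁻¹' Metric.sphere (0:E) (δ/2)
  have hSpre : IsPreconnected S := by
    refine (Topology.IsInducing.subtypeVal (t := {u : E | u ∈ V ∧ u ≠ 0})).isPreconnected_image.1 ?_
    convert hSc.isPreconnected using 1
    ext u
    constructor
    · rintro ⟨v, hv, rfl⟩; exact hv
    · intro hu; exact ⟨⟨u, hS u hu⟩, hu, rfl⟩
  obtain ⟨u0, hu0⟩ := hSc.nonempty
  let u : E0 := ⟨u0, hS _ hu0⟩
  have huS : u ∈ S := hu0
  have hnuS : ng u ∈ S := by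
    change -u0 ∈ Metric.sphere (0:E) (δ/2)
    simpa using hu0
  have hune : u ≠ ng u := by
    intro h
    exact u.2.2 (eq_zero_of_eq_neg' (congrArg Subtype.val h))
  have hth : σ (p (ng u)) = σ (p u) := by rw [hpng]
  rcases hpf (σ (p u)) u (hpσ _) with h | h
  · have := cov.eqOn_of_comp_eqOn (g₁ := fun v => σ (p v)) (g₂ := id) hSpre
      (hσc.comp hpc).continuousOn continuousOn_id (fun v _ => hpσ _) huS h
    have h2 := this hnuS
    simp only [id] at h2
    exact hune (by rw [← h2, hth, h])
  · have := cov.eqOn_of_comp_eqOn (g₁ := fun v => σ (p v)) (g₂ := ng) hSpre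
      (hσc.comp hpc).continuousOn hngc.continuousOn (fun v _ => (hpσ _).trans (hpng v).symm) huS h
    have h2 := this hnuS
    simp only at h2
    have h3 : ng (ng u) = u := Subtype.ext (neg_neg _)
    rw [hth, h, h3] at h2
    exact hune h2.symm

lemma univBall_emb {E : Type*} [NormedAddCommGroup E] [NormedSpace ℝ E] (c : E) (r : ℝ) :
    Topology.IsOpenEmbedding (OpenPartialHomeomorph.univBall c r : E → E) :=
  OpenPartialHomeomorph.isOpenEmbedding _ (OpenPartialHomeomorph.univBall_source c r)

lemma univBall_mem {E : Type*} [NormedAddCommGroup E] [NormedSpace ℝ E] (c : E) {r : ℝ} (hr : 0 < r)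
    (u : E) : OpenPartialHomeomorph.univBall c r u ∈ Metric.ball c r := by
  rw [← OpenPartialHomeomorph.univBall_target c hr]
  exact (OpenPartialHomeomorph.univBall c r).map_source (by simp)

theorem no_euclid {E X : Type*} [NormedAddCommGroup E] [NormedSpace ℝ E] [TopologicalSpace X]
    (hrk : 1 < Module.rank ℝ E) (B : Set E) (hBo : IsOpen B) (h0B : 0 ∈ B) (hBn : ∀ u ∈ B, -u ∈ B)
    (F : E → X) (hF : ContinuousOn F B) (hFo : ∀ O ⊆ B, IsOpen O → IsOpen (F '' O))
    (hfib : ∀ u ∈ B, ∀ v ∈ B, F u = F v ↔ (u = v ∨ u = -v))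
    (g : E3 → X) (hg : Topology.IsOpenEmbedding g) (hg0 : F 0 ∈ Set.range g) : False := by
  obtain ⟨a, ha⟩ := hg0
  have hO : IsOpen (g ⁻¹' (F '' B)) := (hFo B subset_rfl hBo).preimage hg.continuous
  obtain ⟨ρ, hρ, hball⟩ := Metric.isOpen_iff.1 hO a ⟨0, h0B, ha.symm⟩
  let g' : E3 → X := g ∘ OpenPartialHomeomorph.univBall a ρ
  have hg' : Topology.IsOpenEmbedding g' := hg.comp (univBall_emb a ρ)
  have hg'0 : g' 0 = F 0 := by simp [g', ha]
  let G := hg'.toOpenPartialHomeomorph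
  have hGt : G.target = Set.range g' := hg'.toOpenPartialHomeomorph_target
  have hGl : ∀ w, G.symm (g' w) = w := fun w => hg'.toOpenPartialHomeomorph_left_inv
  have hGr : ∀ x ∈ Set.range g', g' (G.symm x) = x := by
    rintro _ ⟨w, rfl⟩; rw [hGl]
  have hVo : IsOpen (B ∩ F ⁻¹' Set.range g') := hF.isOpen_inter_preimage hBo hg'.isOpen_range
  refine no_antipodal hrk (B ∩ F ⁻¹' Set.range g') hVo ⟨h0B, 0, hg'0⟩ ?_ (fun u => G.symm (F u)) ?_ ?_ ?_ ?_ ?_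
  · rintro u ⟨hu, hu2⟩
    refine ⟨hBn u hu, ?_⟩
    have : F (-u) = F u := (hfib _ (hBn u hu) _ hu).2 (Or.inr rfl)
    change F (-u) ∈ Set.range g'
    rw [this]; exact hu2
  · have h1 : ContinuousOn G.symm (Set.range g') := by rw [← hGt]; exact G.continuousOn_symm
    exact h1.comp (hF.mono Set.inter_subset_left) (fun u hu => hu.2)
  · intro O hOV hO
    have : (fun u => G.symm (F u)) '' O = g' ⁻¹' (F '' O) := by
      ext w
      constructor
      · rintro ⟨u, hu, rfl⟩
        refine ⟨u, hu, (hGr _ (hOV hu).2).symm⟩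
      · rintro ⟨u, hu, h⟩
        refine ⟨u, hu, ?_⟩
        simp only [h, hGl]
    rw [this]
    exact (hFo O (hOV.trans Set.inter_subset_left) hO).preimage hg'.continuous
  · intro w
    obtain ⟨u, hu, h⟩ := hball (univBall_mem a hρ w)
    have h2 : F u = g' w := h
    exact ⟨u, ⟨hu, w, h2.symm⟩, by rw [h2, hGl]⟩
  · change G.symm (F 0) = 0
    rw [← hg'0, hGl]
  · intro u hu v hv
    rw [← hfib u hu.1 v hv.1]
    constructor
    · intro h
      have := congrArg g' h
      simpa [hGr _ hu.2, hGr _ hv.2] using this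
    · intro h; simp only [h]

theorem euclid_of_inj {E X : Type*} [NormedAddCommGroup E] [NormedSpace ℝ E] [FiniteDimensional ℝ E]
    [TopologicalSpace X]
    (hrk : Module.finrank ℝ E = 3) (B : Set E) (hBo : IsOpen B) (u0 : E) (h0B : u0 ∈ B)
    (F : E → X) (hF : ContinuousOn F B) (hFo : ∀ O ⊆ B, IsOpen O → IsOpen (F '' O))
    (hinj : Set.InjOn F B) :
    ∃ g : E3 → X, Topology.IsOpenEmbedding g ∧ F u0 ∈ Set.range g ∧ Set.range g ⊆ F '' B := by
  obtain ⟨ρ, hρ, hball⟩ := Metric.isOpen_iff.1 hBo u0 h0B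
  let L : E3 ≃L[ℝ] E := ContinuousLinearEquiv.ofFinrankEq (by rw [hrk, finrank_euclideanSpace_fin])
  have hm : ∀ u, OpenPartialHomeomorph.univBall u0 ρ u ∈ B := fun u => hball (univBall_mem u0 hρ u)
  have hc : Topology.IsOpenEmbedding (fun u => F (OpenPartialHomeomorph.univBall u0 ρ u)) := by
    apply Topology.IsOpenEmbedding.of_continuous_injective_isOpenMap
    · exact hF.comp_continuous (OpenPartialHomeomorph.continuous_univBall u0 ρ) hm
    · intro u v h
      exact (univBall_emb u0 ρ).injective (hinj (hm u) (hm v) h)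
    · intro O hO
      have := hFo _ (by rintro _ ⟨u, _, rfl⟩; exact hm u) ((univBall_emb u0 ρ).isOpenMap O hO)
      rwa [Set.image_image] at this
  refine ⟨_, hc.comp L.toHomeomorph.isOpenEmbedding, ⟨0, ?_⟩, ?_⟩
  · simp
  · rintro _ ⟨w, rfl⟩
    exact ⟨_, hm _, rfl⟩

theorem locEuclidean_iff (Z : Type) [TopologicalSpace Z] :
    LocEuclidean 3 Z ↔ ∀ z : Z, ∃ g : E3 → Z, Topology.IsOpenEmbedding g ∧ z ∈ Set.range g := by
  constructor
  · intro h z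
    obtain ⟨U, hU, hz, ⟨φ⟩⟩ := h z
    refine ⟨_, hU.isOpenEmbedding_subtypeVal.comp φ.symm.isOpenEmbedding, φ ⟨z, hz⟩, ?_⟩
    simp
  · intro h z
    obtain ⟨g, hg, hz⟩ := h z
    exact ⟨Set.range g, hg.isOpen_range, hz, ⟨hg.isEmbedding.toHomeomorph.symm⟩⟩

theorem locEuclidean_open_iff {X : Type} [TopologicalSpace X] (S : Set X) (hS : IsOpen S) :
    LocEuclidean 3 S ↔ ∀ z ∈ S, ∃ g : E3 → X, Topology.IsOpenEmbedding g ∧ z ∈ Set.range g ∧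
      Set.range g ⊆ S := by
  rw [locEuclidean_iff]
  constructor
  · intro h z hz
    obtain ⟨g, hg, w, hw⟩ := h ⟨z, hz⟩
    refine ⟨_, hS.isOpenEmbedding_subtypeVal.comp hg, ⟨w, by simp [hw]⟩, ?_⟩
    rintro _ ⟨w, rfl⟩; exact (g w).2
  · rintro h ⟨z, hz⟩
    obtain ⟨g, hg, ⟨w, hw⟩, hgS⟩ := h z hz
    refine ⟨fun w => ⟨g w, hgS ⟨w, rfl⟩⟩, ?_, w, Subtype.ext hw⟩
    exact Topology.IsOpenEmbedding.of_comp _ hS.isOpenEmbedding_subtypeVal hg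

/-! ### Flags and the dihedral action around edges -/

abbrev EFlag (D : GlueingDatum 3) := D.I × Equiv.Perm (Fin 4)

def flR (D : GlueingDatum 3) : Equiv.Perm (EFlag D) :=
  Function.Involutive.toPerm (fun f => (f.1, f.2 * Equiv.swap 2 3)) (by
    rintro ⟨i, σ⟩; simp [mul_assoc])

def flS (D : GlueingDatum 3) : Equiv.Perm (EFlag D) :=
  Function.Involutive.toPerm (fun f => (f.1, f.2 * Equiv.swap 0 1)) (by
    rintro ⟨i, σ⟩; simp [mul_assoc])

def flA (D : GlueingDatum 3) : Equiv.Perm (EFlag D) :=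
  Function.Involutive.toPerm
    (fun f => ((D.P (f.1, f.2 2)).1, D.glue (f.1, f.2 2) * f.2)) (by
    rintro ⟨i, σ⟩
    have h1 := D.glue_face (i, σ 2)
    simp only at h1
    simp [h1, D.P_involutive, D.glue_symm]
    ext1 a; simp)

def flT (D : GlueingDatum 3) : Equiv.Perm (EFlag D) := flR D * flA D

lemma flR_apply (D : GlueingDatum 3) (f : EFlag D) : flR D f = (f.1, f.2 * Equiv.swap 2 3) := rfl
lemma flS_apply (D : GlueingDatum 3) (f : EFlag D) : flS D f = (f.1, f.2 * Equiv.swap 0 1) := rfl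
lemma flA_apply (D : GlueingDatum 3) (f : EFlag D) :
    flA D f = ((D.P (f.1, f.2 2)).1, D.glue (f.1, f.2 2) * f.2) := rfl
lemma flT_apply (D : GlueingDatum 3) (f : EFlag D) :
    flT D f = ((D.P (f.1, f.2 2)).1, D.glue (f.1, f.2 2) * f.2 * Equiv.swap 2 3) := rfl

lemma flR_sq (D : GlueingDatum 3) : flR D * flR D = 1 := by
  ext1 f; exact Function.Involutive.toPerm_involutive _ f
lemma flS_sq (D : GlueingDatum 3) : flS D * flS D = 1 := by
  ext1 f; exact Function.Involutive.toPerm_involutive _ f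
lemma flA_sq (D : GlueingDatum 3) : flA D * flA D = 1 := by
  ext1 f; exact Function.Involutive.toPerm_involutive _ f

lemma swap_comm4 : (Equiv.swap 0 1 * Equiv.swap 2 3 : Equiv.Perm (Fin 4)) =
    Equiv.swap 2 3 * Equiv.swap 0 1 := by decide

lemma flSR (D : GlueingDatum 3) : flS D * flR D = flR D * flS D := by
  ext1 f
  simp only [Equiv.Perm.mul_apply, flS_apply, flR_apply, mul_assoc, swap_comm4]

lemma flSA (D : GlueingDatum 3) : flS D * flA D = flA D * flS D := by
  ext1 f
  have : (Equiv.swap 0 1 : Equiv.Perm (Fin 4)) 2 = 2 := by decide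
  simp only [Equiv.Perm.mul_apply, flS_apply, flA_apply, mul_assoc, this]

lemma flST (D : GlueingDatum 3) : flS D * flT D = flT D * flS D := by
  rw [flT, ← mul_assoc, flSR, mul_assoc, flSA, mul_assoc]

lemma swap_ne1 : (Equiv.swap 2 3 : Equiv.Perm (Fin 4)) ≠ 1 := by decide
lemma swap_ne2 : (Equiv.swap 0 1 : Equiv.Perm (Fin 4)) ≠ 1 := by decide
lemma swap_ne3 : (Equiv.swap 2 3 * Equiv.swap 0 1 : Equiv.Perm (Fin 4)) ≠ 1 := by decide

lemma flR_ne (D : GlueingDatum 3) (f : EFlag D) : flR D f ≠ f := by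
  intro h
  have := congrArg Prod.snd h
  simp only [flR_apply, mul_eq_left] at this
  exact swap_ne1 this

lemma flS_ne (D : GlueingDatum 3) (f : EFlag D) : flS D f ≠ f := by
  intro h
  have := congrArg Prod.snd h
  simp only [flS_apply, mul_eq_left] at this
  exact swap_ne2 this

lemma flSR_ne (D : GlueingDatum 3) (f : EFlag D) : (flS D * flR D) f ≠ f := by
  intro h
  have := congrArg Prod.snd h
  simp only [Equiv.Perm.mul_apply, flS_apply, flR_apply, mul_assoc, mul_eq_left] at this
  exact swap_ne3 this

lemma flA_ne (D : GlueingDatum 3) (f : EFlag D) : flA D f ≠ f := by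
  intro h
  apply D.P_fixedPointFree (f.1, f.2 2)
  have h1 := congrArg Prod.fst h
  have h2 := congrArg (fun f : EFlag D => f.2 2) h
  simp only [flA_apply] at h1 h2
  have h3 := D.glue_face (f.1, f.2 2)
  exact Prod.ext h1 (h3.symm.trans h2)

lemma flSA_ne (D : GlueingDatum 3) (f : EFlag D) : (flS D * flA D) f ≠ f := by
  intro h
  apply D.P_fixedPointFree (f.1, f.2 2)
  have h1 := congrArg Prod.fst h
  have h2 := congrArg (fun f : EFlag D => f.2 2) h
  have h4 : (Equiv.swap 0 1 : Equiv.Perm (Fin 4)) 2 = 2 := by decide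
  simp only [flA_apply, flS_apply, Equiv.Perm.mul_apply, h4] at h1 h2
  have h3 := D.glue_face (f.1, f.2 2)
  exact Prod.ext h1 (h3.symm.trans h2)

lemma dihedral_ne {α : Type*} (R A T : Equiv.Perm α) (hT : T = R * A) (hR : R * R = 1) (hA : A * A = 1)
    (hRn : ∀ x, R x ≠ x) (hAn : ∀ x, A x ≠ x) (m : ℤ) (x : α) : (T ^ m) x ≠ R x := by
  intro h
  have hRi : R⁻¹ = R := inv_eq_of_mul_eq_one_left hR
  have hAi : A⁻¹ = A := inv_eq_of_mul_eq_one_left hA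
  have hconj : ∀ s : ℤ, T ^ (-s) * R = R * T ^ s := by
    intro s
    have h1 : R * T * R⁻¹ = T⁻¹ := by
      rw [hT, mul_inv_rev, hRi, hAi, ← mul_assoc, hR, one_mul]
    have h2 : R * T ^ s * R⁻¹ = T ^ (-s) := by
      rw [← conj_zpow, h1, inv_zpow']
    rw [← h2, inv_mul_cancel_right]
  have key : ∀ s r : ℤ, m = s + r → (T ^ r) x = R ((T ^ s) x) := by
    intro s r hm
    have h3 : (T ^ (-s)) ((T ^ m) x) = (T ^ (-s)) (R x) := by rw [h]
    rw [← Equiv.Perm.mul_apply, ← Equiv.Perm.mul_apply, ← zpow_add, hconj, hm] at h3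
    simpa using h3
  rcases Int.even_or_odd m with ⟨s, hs⟩ | ⟨s, hs⟩
  · exact hRn _ (key s s hs).symm
  · have := key s (1 + s) (by omega)
    rw [zpow_one_add, Equiv.Perm.mul_apply] at this
    nth_rewrite 1 [hT] at this
    rw [Equiv.Perm.mul_apply] at this
    exact hAn _ (R.injective this)

lemma flR_orbit (D : GlueingDatum 3) (m : ℤ) (f : EFlag D) : (flT D ^ m) f ≠ flR D f :=
  dihedral_ne (flR D) (flA D) (flT D) rfl (flR_sq D) (flA_sq D) (flR_ne D) (flA_ne D) m f

lemma flSR_orbit (D : GlueingDatum 3) (m : ℤ) (f : EFlag D) : (flT D ^ m) f ≠ (flS D * flR D) f := by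
  refine dihedral_ne (flS D * flR D) (flS D * flA D) (flT D) ?_ ?_ ?_ (flSR_ne D) (flSA_ne D) m f
  · rw [flSR, mul_assoc, ← mul_assoc (flS D), flS_sq, one_mul]; rfl
  · rw [flSR, mul_assoc, ← flSR, ← mul_assoc (flS D), flS_sq, one_mul, flR_sq]
  · rw [flSA, mul_assoc, ← flSA, ← mul_assoc (flS D), flS_sq, one_mul, flA_sq]

/-- No edge is identified with its reverse. -/
def NoRev (D : GlueingDatum 3) : Prop := ∀ (f : EFlag D) (m : ℤ), (flT D ^ m) f ≠ flS D f

lemma exists_flag {D : GlueingDatum 3} (i : D.I) (a b : Fin 4) (h : a ≠ b) :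
    ∃ σ : Equiv.Perm (Fin 4), σ 0 = a ∧ σ 1 = b := by
  revert a b; decide

theorem noRev_of_dir (D : GlueingDatum 3) (h : Dir D) : NoRev D := by
  obtain ⟨o, ho1, ho2⟩ := h
  intro f m hm
  have hinv : ∀ g : EFlag D, o g.1 (g.2 0) (g.2 1) ↔ o (flT D g).1 ((flT D g).2 0) ((flT D g).2 1) := by
    intro g
    have h0 : (Equiv.swap 2 3 : Equiv.Perm (Fin 4)) 0 = 0 := by decide
    have h1 : (Equiv.swap 2 3 : Equiv.Perm (Fin 4)) 1 = 1 := by decide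
    simp only [flT_apply, Equiv.Perm.mul_apply, h0, h1]
    exact ho2 g.1 (g.2 2) (g.2 0) (g.2 1) (by simp) (by simp) (by simp)
  have hinv2 : ∀ (m : ℤ) (g : EFlag D), o g.1 (g.2 0) (g.2 1) ↔
      o ((flT D ^ m) g).1 (((flT D ^ m) g).2 0) (((flT D ^ m) g).2 1) := by
    intro m
    induction m with
    | zero => intro g; simp
    | succ n ih =>
      intro g
      rw [add_comm, zpow_one_add, Equiv.Perm.mul_apply, ← hinv]; exact ih g
    | pred n ih =>
      intro g
      rw [sub_eq_add_neg, add_comm, hinv ((flT D ^ (-1 + -(n:ℤ))) g), ← Equiv.Perm.mul_apply, ← zpow_one_add]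
      simpa using ih g
  have h2 := hinv2 m f
  rw [hm] at h2
  simp only [flS_apply, Equiv.Perm.mul_apply, Equiv.swap_apply_left, Equiv.swap_apply_right] at h2
  have := ho1 f.1 (f.2 0) (f.2 1) (by simp)
  rcases this with h | h <;> tauto

theorem dir_of_noRev (D : GlueingDatum 3) (h : NoRev D) : Dir D := by
  let G : Subgroup (Equiv.Perm (EFlag D)) := Subgroup.closure {flT D, flR D}
  let Q := MulAction.orbitRel.Quotient G (EFlag D)
  let mk : EFlag D → Q := Quotient.mk _
  have hT : ∀ f, mk (flT D f) = mk f := fun f => Quotient.sound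
    ⟨⟨flT D, Subgroup.subset_closure (by simp)⟩, rfl⟩
  have hR : ∀ f, mk (flR D f) = mk f := fun f => Quotient.sound
    ⟨⟨flR D, Subgroup.subset_closure (by simp)⟩, rfl⟩
  have hA : ∀ f, mk (flA D f) = mk f := by
    intro f
    rw [← hR (flA D f)]; exact hT f
  have hS : ∀ f, mk (flS D f) ≠ mk f := by
    intro f hf
    obtain ⟨⟨g, hg⟩, hgf⟩ := Quotient.exact hf
    have hgf : g f = flS D f := hgf
    have hstr : ∀ g ∈ G, ∃ m : ℤ, g = flT D ^ m ∨ g = flR D * flT D ^ m := by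
      have hRi : (flR D)⁻¹ = flR D := inv_eq_of_mul_eq_one_left (flR_sq D)
      have hAi : (flA D)⁻¹ = flA D := inv_eq_of_mul_eq_one_left (flA_sq D)
      have hconj : ∀ s : ℤ, flT D ^ s * flR D = flR D * flT D ^ (-s) := by
        intro s
        have h1 : (flR D) * flT D * (flR D)⁻¹ = (flT D)⁻¹ := by
          rw [flT, mul_inv_rev, hRi, hAi, ← mul_assoc, flR_sq, one_mul]
        have h2 : flR D * flT D ^ (-s) * (flR D)⁻¹ = flT D ^ s := by
          rw [← conj_zpow, h1, inv_zpow', neg_neg]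
        rw [← h2, inv_mul_cancel_right]
      intro g hg
      induction hg using Subgroup.closure_induction with
      | mem x hx =>
        rcases hx with rfl | rfl
        · exact ⟨1, Or.inl (by simp)⟩
        · exact ⟨0, Or.inr (by simp)⟩
      | one => exact ⟨0, Or.inl (by simp)⟩
      | mul x y _ _ hx hy =>
        obtain ⟨m, rfl | rfl⟩ := hx <;> obtain ⟨k, rfl | rfl⟩ := hy
        · exact ⟨m + k, Or.inl (by rw [zpow_add])⟩
        · exact ⟨-m + k, Or.inr (by rw [← mul_assoc, hconj, mul_assoc, zpow_add])⟩
        · exact ⟨m + k, Or.inr (by rw [mul_assoc, zpow_add])⟩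
        · refine ⟨-m + k, Or.inl ?_⟩
          rw [mul_assoc, ← mul_assoc (flT D ^ m), hconj, ← mul_assoc, ← mul_assoc, flR_sq, one_mul, zpow_add]
      | inv x _ hx =>
        obtain ⟨m, rfl | rfl⟩ := hx
        · exact ⟨-m, Or.inl (by rw [zpow_neg])⟩
        · refine ⟨m, Or.inr ?_⟩
          rw [mul_inv_rev, hRi, ← zpow_neg, hconj, neg_neg]
    obtain ⟨m, rfl | rfl⟩ := hstr g hg
    · exact h f m hgf
    · apply flSR_orbit D m f
      have := congrArg (flR D) hgf
      rw [Equiv.Perm.mul_apply, ← Equiv.Perm.mul_apply (flR D) (flR D), flR_sq] at this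
      rw [flSR]; simpa using this
  let lo : LinearOrder Q := linearOrderOfSTO WellOrderingRel
  have hfl : ∀ f g : EFlag D, f.1 = g.1 → f.2 0 = g.2 0 → f.2 1 = g.2 1 → mk f = mk g := by
    rintro ⟨i, σ⟩ ⟨j, τ⟩ h1 h2 h3
    simp only at h1 h2 h3
    subst h1
    have : ∀ ρ : Equiv.Perm (Fin 4), ρ 0 = 0 → ρ 1 = 1 → ρ = 1 ∨ ρ = Equiv.swap 2 3 := by decide
    rcases this (σ⁻¹ * τ) (by simp [← h2]) (by simp [← h3]) with h | h
    · rw [inv_mul_eq_one] at h; rw [h]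
    · rw [inv_mul_eq_iff_eq_mul] at h
      rw [h]; exact (hR (i, σ)).symm
  refine ⟨fun i a b => ∃ σ : Equiv.Perm (Fin 4), σ 0 = a ∧ σ 1 = b ∧ mk (i, σ) < mk (flS D (i, σ)), ?_, ?_⟩
  · intro i a b hab
    obtain ⟨σ, h0, h1⟩ := exists_flag i a b hab
    have hSS : flS D (flS D (i, σ)) = (i, σ) := by
      rw [← Equiv.Perm.mul_apply, flS_sq]; rfl
    have e1 : (∃ τ : Equiv.Perm (Fin 4), τ 0 = a ∧ τ 1 = b ∧ mk (i, τ) < mk (flS D (i, τ))) ↔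
        mk (i, σ) < mk (flS D (i, σ)) := by
      constructor
      · rintro ⟨τ, t0, t1, ht⟩
        rwa [hfl (i, σ) (i, τ) rfl (h0.trans t0.symm) (h1.trans t1.symm),
          hfl (flS D (i, σ)) (flS D (i, τ)) rfl (by simp [flS_apply, h1, t1]) (by simp [flS_apply, h0, t0])]
      · intro h; exact ⟨σ, h0, h1, h⟩
    have e2 : (∃ τ : Equiv.Perm (Fin 4), τ 0 = b ∧ τ 1 = a ∧ mk (i, τ) < mk (flS D (i, τ))) ↔
        mk (flS D (i, σ)) < mk (i, σ) := by
      constructor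
      · rintro ⟨τ, t0, t1, ht⟩
        rwa [hfl (i, σ) (flS D (i, τ)) rfl (by simp [flS_apply, h0, t1]) (by simp [flS_apply, h1, t0]),
          hfl (flS D (i, σ)) (i, τ) rfl (by simp [flS_apply, h1, t0]) (by simp [flS_apply, h0, t1])]
      · intro h
        refine ⟨σ * Equiv.swap 0 1, by simp [h1], by simp [h0], ?_⟩
        change mk (flS D (i, σ)) < mk (flS D (flS D (i, σ)))
        rwa [hSS]
    simp only [e1, e2]
    rcases lt_or_gt_of_ne (hS (i, σ)) with h | h
    · exact Or.inr ⟨h, not_lt_of_gt h⟩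
    · exact Or.inl ⟨h, not_lt_of_gt h⟩
  · intro i k a b hak hbk hab
    have main : ∀ (i : D.I) (k a b : Fin 4), a ≠ k → b ≠ k → a ≠ b →
        (∃ τ : Equiv.Perm (Fin 4), τ 0 = a ∧ τ 1 = b ∧ mk (i, τ) < mk (flS D (i, τ))) →
        (∃ τ : Equiv.Perm (Fin 4), τ 0 = D.glue (i, k) a ∧ τ 1 = D.glue (i, k) b ∧
          mk ((D.P (i, k)).1, τ) < mk (flS D ((D.P (i, k)).1, τ))) := by
      rintro i k a b hak hbk hab ⟨τ, t0, t1, ht⟩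
      have : ∃ σ : Equiv.Perm (Fin 4), σ 0 = a ∧ σ 1 = b ∧ σ 2 = k := by
        clear * - hak hbk hab
        revert a b k; decide
      obtain ⟨σ, s0, s1, s2⟩ := this
      refine ⟨D.glue (i, k) * σ, by simp [s0], by simp [s1], ?_⟩
      have e : ((D.P (i, k)).1, D.glue (i, k) * σ) = flA D (i, σ) := by
        rw [flA_apply]; simp only [s2]
      rw [e, ← Equiv.Perm.mul_apply, flSA, Equiv.Perm.mul_apply, hA, hA]
      rwa [hfl (i, σ) (i, τ) rfl (s0.trans t0.symm) (s1.trans t1.symm),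
        hfl (flS D (i, σ)) (flS D (i, τ)) rfl (by simp [flS_apply, s1, t1]) (by simp [flS_apply, s0, t0])]
    refine ⟨main i k a b hak hbk hab, fun h => ?_⟩
    have h3 := D.glue_face (i, k)
    simp only at h3
    have := main (D.P (i, k)).1 (D.P (i, k)).2 (D.glue (i, k) a) (D.glue (i, k) b)
      (by rw [← h3]; simpa using hak) (by rw [← h3]; simpa using hbk) (by simpa using hab) h
    simpa [D.P_involutive, D.glue_symm] using this

/-! ### Geometry around an edge -/

def dperm (τ : Equiv.Perm (Fin 4)) (x : Delta 3) : Delta 3 :=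
  ⟨x.1 ∘ τ, fun v => x.2.1 (τ v), by
    exact (Equiv.sum_comp τ x.1).trans x.2.2⟩

lemma dperm_apply (τ : Equiv.Perm (Fin 4)) (x : Delta 3) (a : Fin 4) :
    (dperm τ x).1 a = x.1 (τ a) := rfl

lemma dperm_dperm (τ ρ : Equiv.Perm (Fin 4)) (x : Delta 3) :
    dperm τ (dperm ρ x) = dperm (ρ * τ) x := rfl

lemma dperm_one (x : Delta 3) : dperm 1 x = x := rfl

lemma dperm_cont (τ : Equiv.Perm (Fin 4)) : Continuous (dperm τ) := by
  refine Continuous.subtype_mk ?_ _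
  exact continuous_pi fun a => (continuous_apply (τ a)).comp continuous_subtype_val

def dpermHomeo (τ : Equiv.Perm (Fin 4)) : Delta 3 ≃ₜ Delta 3 where
  toFun := dperm τ
  invFun := dperm τ⁻¹
  left_inv x := by rw [dperm_dperm, mul_inv_cancel, dperm_one]
  right_inv x := by rw [dperm_dperm, inv_mul_cancel, dperm_one]
  continuous_toFun := dperm_cont τ
  continuous_invFun := dperm_cont τ⁻¹

/-- The point of the disjoint union with coordinates `x` relative to a flag. -/
def iot (D : GlueingDatum 3) (fl : EFlag D) (x : Delta 3) : GlueTotal D :=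
  ⟨fl.1, dperm fl.2⁻¹ x⟩

lemma iot_openMap (D : GlueingDatum 3) (fl : EFlag D) : IsOpenMap (iot D fl) :=
  (isOpenMap_sigmaMk (σ := fun _ : D.I => Delta 3) (i := fl.1)).comp (dpermHomeo fl.2⁻¹).isOpenMap

lemma iot_cont (D : GlueingDatum 3) (fl : EFlag D) : Continuous (iot D fl) :=
  (continuous_sigmaMk (σ := fun _ : D.I => Delta 3) (i := fl.1)).comp (dperm_cont _)

lemma iot_inj (D : GlueingDatum 3) (fl : EFlag D) : Function.Injective (iot D fl) := by
  intro x y h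
  have h2 : dperm fl.2⁻¹ x = dperm fl.2⁻¹ y := by
    simpa [iot] using h
  exact (dpermHomeo fl.2⁻¹).injective h2

/-- Right translation of the flag. -/
lemma iot_perm (D : GlueingDatum 3) (fl : EFlag D) (τ : Equiv.Perm (Fin 4)) (x : Delta 3) :
    iot D (fl.1, fl.2 * τ) (dperm τ x) = iot D fl x := by
  simp only [iot, dperm_dperm]
  congr 2
  group

/-- Two presentations of the same point. -/
lemma iot_eq (D : GlueingDatum 3) (fl fl' : EFlag D) (x x' : Delta 3)
    (h : iot D fl x = iot D fl' x') :
    ∃ τ : Equiv.Perm (Fin 4), fl' = (fl.1, fl.2 * τ) ∧ x' = dperm τ x := by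
  refine ⟨fl.2⁻¹ * fl'.2, ?_, ?_⟩
  · have h1 : fl.1 = fl'.1 := congrArg Sigma.fst h
    exact Prod.ext h1.symm (by simp)
  · have h2 : dperm fl.2⁻¹ x = dperm fl'.2⁻¹ x' := by
      have h1 : fl.1 = fl'.1 := congrArg Sigma.fst h
      simp only [iot] at h
      exact congrArg (fun p : (Σ _ : D.I, Delta 3) => p.2) h
    rw [← dperm_dperm, h2, dperm_dperm, inv_mul_cancel, dperm_one]

lemma glueRel_symm (D : GlueingDatum 3) {p q : GlueTotal D} (h : glueRel D p q) : glueRel D q p := by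
  obtain ⟨k, h0, h1, h2⟩ := h
  have h3 := D.glue_face (p.1, k)
  simp only at h3
  have h4 : (q.1, (D.P (p.1, k)).2) = D.P (p.1, k) := Prod.ext h1.symm rfl
  refine ⟨(D.P (p.1, k)).2, ?_, ?_, ?_⟩
  · rw [h2, ← h3]; simpa using h0
  · rw [h4, D.P_involutive]
  · rw [h4, D.glue_symm, h2]
    ext a; simp

lemma glueTotal_ext (D : GlueingDatum 3) {p q : GlueTotal D} (h1 : p.1 = q.1) (h2 : p.2.1 = q.2.1) :
    p = q := by
  obtain ⟨i, x⟩ := p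
  obtain ⟨j, y⟩ := q
  simp only at h1 h2
  subst h1
  rw [Subtype.ext h2]

abbrev sw : Equiv.Perm (Fin 4) := Equiv.swap 2 3
abbrev sw' : Equiv.Perm (Fin 4) := Equiv.swap 0 1

lemma glue_two (D : GlueingDatum 3) (fl : EFlag D) (x : Delta 3) (q : GlueTotal D)
    (h1 : (D.P (fl.1, fl.2 2)).1 = q.1)
    (h2 : q.2.1 = (iot D fl x).2.1 ∘ (D.glue (fl.1, fl.2 2)).symm) :
    q = iot D (flT D fl) (dperm sw x) := by
  apply glueTotal_ext
  · exact h1.symm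
  · rw [h2]
    ext a
    simp [iot, dperm_apply, flT_apply, Function.comp, Equiv.Perm.mul_apply, mul_inv_rev, ← Equiv.Perm.inv_def]

lemma glueRel_two (D : GlueingDatum 3) (fl : EFlag D) (x : Delta 3) (hx : x.1 2 = 0) :
    glueRel D (iot D fl x) (iot D (flT D fl) (dperm sw x)) := by
  refine ⟨fl.2 2, ?_, rfl, ?_⟩
  · simpa [iot, dperm_apply] using hx
  · ext a
    simp [iot, dperm_apply, flT_apply, Function.comp, Equiv.Perm.mul_apply, mul_inv_rev, ← Equiv.Perm.inv_def]

lemma flT_inv (D : GlueingDatum 3) : (flT D)⁻¹ = flA D * flR D := by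
  rw [flT, mul_inv_rev, inv_eq_of_mul_eq_one_left (flR_sq D), inv_eq_of_mul_eq_one_left (flA_sq D)]

lemma glue_three (D : GlueingDatum 3) (fl : EFlag D) (x : Delta 3) (q : GlueTotal D)
    (h1 : (D.P (fl.1, fl.2 3)).1 = q.1)
    (h2 : q.2.1 = (iot D fl x).2.1 ∘ (D.glue (fl.1, fl.2 3)).symm) :
    q = iot D ((flT D)⁻¹ fl) (dperm sw x) := by
  rw [flT_inv]
  apply glueTotal_ext
  · rw [← h1]; simp [iot, flA_apply, flR_apply]
  · rw [h2]
    ext a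
    simp [iot, dperm_apply, flA_apply, flR_apply, Function.comp, Equiv.Perm.mul_apply, mul_inv_rev, ← Equiv.Perm.inv_def]

lemma delta_sum (x : Delta 3) : x.1 0 + x.1 1 + x.1 2 + x.1 3 = 1 := by
  have := x.2.2
  rwa [Fin.sum_univ_four] at this

/-! #### The planar model -/

def gm (n : ℕ) (j : ℤ) (x : Delta 3) : ℂ × ℝ :=
  (((x.1 2 + x.1 3 : ℝ) : ℂ) *
    Complex.exp (((2 * Real.pi * ((j : ℝ) + x.1 3 / (x.1 2 + x.1 3)) / n : ℝ) : ℂ) * Complex.I),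
    x.1 0 - x.1 1)

lemma gm_norm (n : ℕ) (j : ℤ) (x : Delta 3) : ‖(gm n j x).1‖ = x.1 2 + x.1 3 := by
  rw [gm, norm_mul, Complex.norm_exp_ofReal_mul_I, mul_one, Complex.norm_real, Real.norm_eq_abs,
    abs_of_nonneg (add_nonneg (x.2.1 2) (x.2.1 3))]

lemma gm_cont (n : ℕ) (j : ℤ) : Continuous (gm n j) := by
  have hc : ∀ a : Fin 4, Continuous fun x : Delta 3 => x.1 a := fun a =>
    (continuous_apply a).comp continuous_subtype_val
  refine Continuous.prodMk ?_ ((hc 0).sub (hc 1))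
  rw [continuous_iff_continuousAt]
  intro x
  by_cases hx : x.1 2 + x.1 3 = 0
  · have hz : ‖(gm n j x).1‖ = 0 := by rw [gm_norm, hx]
    have hz' : (gm n j x).1 = 0 := norm_eq_zero.1 hz
    change Filter.Tendsto (fun y => (gm n j y).1) (𝓝 x) (𝓝 (gm n j x).1)
    rw [hz', tendsto_zero_iff_norm_tendsto_zero]
    simp only [gm_norm]
    have : Filter.Tendsto (fun y : Delta 3 => y.1 2 + y.1 3) (𝓝 x) (𝓝 (x.1 2 + x.1 3)) :=
      ((hc 2).add (hc 3)).tendsto x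
    rwa [hx] at this
  · apply ContinuousAt.mul
    · exact (Complex.continuous_ofReal.comp ((hc 2).add (hc 3))).continuousAt
    · apply Complex.continuous_exp.continuousAt.comp
      apply ContinuousAt.mul _ continuousAt_const
      apply Complex.continuous_ofReal.continuousAt.comp
      apply ContinuousAt.div_const
      apply ContinuousAt.mul continuousAt_const
      apply ContinuousAt.add continuousAt_const
      exact (hc 3).continuousAt.div ((hc 2).add (hc 3)).continuousAt hx

lemma gm_period (n : ℕ) (hn : 0 < n) (j k : ℤ) (x : Delta 3) (h : (n : ℤ) ∣ k - j) :
    gm n j x = gm n k x := by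
  obtain ⟨c, hc⟩ := h
  have hk : (k : ℝ) = j + n * c := by
    have : k = j + n * c := by omega
    exact_mod_cast this
  have hn' : (n : ℝ) ≠ 0 := by positivity
  simp only [gm]
  congr 2
  rw [hk, Complex.exp_eq_exp_iff_exists_int]
  refine ⟨-c, ?_⟩
  push_cast
  have hn'' : (n : ℂ) ≠ 0 := by exact_mod_cast hn'
  field_simp
  ring

lemma gm_zero (n : ℕ) (j k : ℤ) (x : Delta 3) (h2 : x.1 2 = 0) (h3 : x.1 3 = 0) :
    gm n j x = gm n k x := by
  simp [gm, h2, h3]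

lemma gm_succ (n : ℕ) (j : ℤ) (x : Delta 3) (h2 : x.1 2 = 0) :
    gm n j x = gm n (j + 1) (dperm sw x) := by
  by_cases h3 : x.1 3 = 0
  · simp [gm, h2, h3, dperm_apply, Equiv.swap_apply_def]
  · simp [gm, h2, h3, dperm_apply, Equiv.swap_apply_def]

lemma delta_ext {x y : Delta 3} (h0 : x.1 0 = y.1 0) (h1 : x.1 1 = y.1 1) (h2 : x.1 2 = y.1 2)
    (h3 : x.1 3 = y.1 3) : x = y := by
  apply Subtype.ext
  funext a
  fin_cases a <;> assumption

lemma gm_eq (n : ℕ) (hn : 0 < n) (j k : ℤ) (x y : Delta 3) (h : gm n j x = gm n k y) :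
    (x = y ∧ x.1 2 = 0 ∧ x.1 3 = 0) ∨ (x = y ∧ (n : ℤ) ∣ k - j) ∨
    ((n : ℤ) ∣ k - (j + 1) ∧ y = dperm sw x ∧ x.1 2 = 0 ∧ 0 < x.1 3) ∨
    ((n : ℤ) ∣ j - (k + 1) ∧ x = dperm sw y ∧ y.1 2 = 0 ∧ 0 < y.1 3) := by
  have hr : x.1 2 + x.1 3 = y.1 2 + y.1 3 := by rw [← gm_norm n j, ← gm_norm n k, h]
  have hs : x.1 0 - x.1 1 = y.1 0 - y.1 1 := congrArg Prod.snd h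
  have hx := delta_sum x
  have hy := delta_sum y
  have e0 : x.1 0 = y.1 0 := by linarith
  have e1 : x.1 1 = y.1 1 := by linarith
  have x2 := x.2.1 2
  have x3 := x.2.1 3
  have y2 := y.2.1 2
  have y3 := y.2.1 3
  by_cases hr0 : x.1 2 + x.1 3 = 0
  · left
    exact ⟨delta_ext e0 e1 (by linarith) (by linarith), by linarith, by linarith⟩
  right
  have hrp : 0 < x.1 2 + x.1 3 := lt_of_le_of_ne (by linarith) (Ne.symm hr0)
  have hrp' : 0 < y.1 2 + y.1 3 := by linarith
  have hz : (gm n j x).1 = (gm n k y).1 := congrArg Prod.fst h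
  simp only [gm, hr] at hz
  have hne : ((y.1 2 + y.1 3 : ℝ) : ℂ) ≠ 0 := by exact_mod_cast hrp'.ne'
  have hz := mul_left_cancel₀ hne hz
  rw [Complex.exp_eq_exp_iff_exists_int] at hz
  obtain ⟨c, hc⟩ := hz
  have hn' : (n : ℝ) ≠ 0 := by positivity
  have hn'' : (n : ℂ) ≠ 0 := by exact_mod_cast hn'
  have hpi : (Real.pi : ℂ) ≠ 0 := by exact_mod_cast Real.pi_ne_zero
  have hc2 : (j : ℝ) + x.1 3 / (y.1 2 + y.1 3) = k + y.1 3 / (y.1 2 + y.1 3) + n * c := by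
    have h1 : 2 * Real.pi * ((j : ℝ) + x.1 3 / (y.1 2 + y.1 3)) / n =
        2 * Real.pi * ((k : ℝ) + y.1 3 / (y.1 2 + y.1 3)) / n + c * (2 * Real.pi) := by
      have h2 : ((2 * Real.pi * ((j : ℝ) + x.1 3 / (y.1 2 + y.1 3)) / n : ℝ) : ℂ) * Complex.I =
        ((2 * Real.pi * ((k : ℝ) + y.1 3 / (y.1 2 + y.1 3)) / n + c * (2 * Real.pi) : ℝ) : ℂ) * Complex.I := by
        rw [hc]; push_cast; ring
      have h3 := mul_right_cancel₀ Complex.I_ne_zero h2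
      exact_mod_cast h3
    have h4 := congrArg (fun w => w * n / (2 * Real.pi)) h1
    have hpi' := Real.pi_ne_zero
    set tx := x.1 3 / (y.1 2 + y.1 3)
    set ty := y.1 3 / (y.1 2 + y.1 3)
    field_simp at h4
    linarith
  set d : ℤ := k + n * c - j with hd
  have hd' : x.1 3 / (y.1 2 + y.1 3) - y.1 3 / (y.1 2 + y.1 3) = d := by
    rw [hd]; push_cast; linarith
  have hd'' : x.1 3 - y.1 3 = d * (y.1 2 + y.1 3) := by
    rw [← hd']; field_simp
  have hdle : (d : ℝ) ≤ 1 := by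
    by_contra hcon
    push Not at hcon
    nlinarith
  have hdge : (-1 : ℝ) ≤ d := by
    by_contra hcon
    push Not at hcon
    nlinarith
  have hdle' : d ≤ 1 := by exact_mod_cast hdle
  have hdge' : -1 ≤ d := by exact_mod_cast hdge
  have hcases : d = 0 ∨ d = 1 ∨ d = -1 := by omega
  have s2 : sw 2 = 3 := by decide
  have s3 : sw 3 = 2 := by decide
  have s0 : sw 0 = 0 := by decide
  have s1 : sw 1 = 1 := by decide
  rcases hcases with h0 | h0 | h0
  · left
    rw [h0] at hd''
    simp only [Int.cast_zero, zero_mul] at hd''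
    refine ⟨delta_ext e0 e1 (by linarith) (by linarith), ⟨-c, ?_⟩⟩
    rw [h0] at hd; linarith
  · right; left
    rw [h0] at hd''
    simp only [Int.cast_one, one_mul] at hd''
    refine ⟨⟨-c, by rw [h0] at hd; linarith⟩, ?_, by linarith, by linarith⟩
    apply delta_ext <;> simp only [dperm_apply, s0, s1, s2, s3] <;> linarith
  · right; right
    rw [h0] at hd''
    simp only [Int.cast_neg, Int.cast_one, neg_mul, one_mul] at hd''
    refine ⟨⟨c, by rw [h0] at hd; linarith⟩, ?_, by linarith, by linarith⟩
    apply delta_ext <;> simp only [dperm_apply, s0, s1, s2, s3] <;> linarith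

lemma gm_surj (n : ℕ) (hn : 0 < n) (u : ℂ × ℝ) (hu : ‖u.1‖ + |u.2| < 1) :
    ∃ (j : ℤ) (x : Delta 3), gm n j x = u := by
  obtain ⟨z, s⟩ := u
  simp only at hu
  have hs := abs_lt.1 (lt_of_le_of_lt (le_add_of_nonneg_left (norm_nonneg z)) hu)
  have hs1 := le_abs_self s
  have hs2 := neg_abs_le s
  have hz := norm_nonneg z
  set a : ℝ := n * z.arg / (2 * Real.pi) with ha
  have hf0 := Int.fract_nonneg a
  have hf1 := (Int.fract_lt_one a).le
  refine ⟨⌊a⌋, ⟨![(1 - ‖z‖ + s) / 2, (1 - ‖z‖ - s) / 2, ‖z‖ * (1 - Int.fract a), ‖z‖ * Int.fract a], ?_, ?_⟩, ?_⟩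
  · intro v
    fin_cases v
    · simp; linarith
    · simp; linarith
    · simp; exact mul_nonneg hz (by linarith)
    · simp; exact mul_nonneg hz hf0
  · rw [Fin.sum_univ_four]; simp; ring
  · have hr : ‖z‖ * (1 - Int.fract a) + ‖z‖ * Int.fract a = ‖z‖ := by ring
    refine Prod.ext ?_ ?_
    · simp only [gm]
      simp [hr]
      by_cases hz0 : z = 0
      · simp [hz0]
      have hz0' : ‖z‖ ≠ 0 := by simpa using hz0
      have h1 : (⌊a⌋ : ℝ) + ‖z‖ * Int.fract a / ‖z‖ = a := by
        rw [mul_div_cancel_left₀ _ hz0']; exact Int.floor_add_fract a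
      have h2 : 2 * Real.pi * ((⌊a⌋ : ℝ) + ‖z‖ * Int.fract a / ‖z‖) / n = z.arg := by
        rw [h1, ha]
        have : (n : ℝ) ≠ 0 := by positivity
        have := Real.pi_ne_zero
        field_simp
      have h3 := congrArg (fun w : ℝ => (w : ℂ)) h2
      push_cast at h3
      rw [h3]
      exact Complex.norm_mul_exp_arg_mul_I z
    · simp [gm]; ring

lemma gm_pos (n : ℕ) (j : ℤ) (x : Delta 3) (h : ‖(gm n j x).1‖ + |(gm n j x).2| < 1) :
    0 < x.1 0 ∧ 0 < x.1 1 := by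
  rw [gm_norm] at h
  have h1 := le_abs_self (gm n j x).2
  have h2 := neg_abs_le (gm n j x).2
  have h3 : (gm n j x).2 = x.1 0 - x.1 1 := rfl
  have := delta_sum x
  constructor <;> linarith

lemma gm_pos3 (n : ℕ) (j : ℤ) (x : Delta 3) (h : 3 * ‖(gm n j x).1‖ + |(gm n j x).2| < 1) :
    x.1 2 + x.1 3 < x.1 0 ∧ x.1 2 + x.1 3 < x.1 1 := by
  rw [gm_norm] at h
  have h1 := le_abs_self (gm n j x).2
  have h2 := neg_abs_le (gm n j x).2
  have h3 : (gm n j x).2 = x.1 0 - x.1 1 := rfl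
  have := delta_sum x
  constructor <;> linarith

lemma gm_neg (n : ℕ) (hn : 0 < n) (j m : ℤ) (x : Delta 3) (h2 : (n : ℤ) ∣ 2 * m) (h1 : ¬ (n : ℤ) ∣ m) :
    gm n (j + m) (dperm sw' x) = -gm n j x := by
  obtain ⟨c, hc⟩ := h2
  have hodd : Odd c := by
    by_contra hcon
    rw [Int.not_odd_iff_even] at hcon
    obtain ⟨d, hd⟩ := hcon
    apply h1
    refine ⟨d, ?_⟩
    rw [hd] at hc
    linarith
  obtain ⟨d, hd⟩ := hodd
  have s2 : sw' 2 = 2 := by decide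
  have s3 : sw' 3 = 3 := by decide
  have s0 : sw' 0 = 1 := by decide
  have s1 : sw' 1 = 0 := by decide
  have hn' : (n : ℂ) ≠ 0 := by exact_mod_cast hn.ne'
  have hm : (2 : ℂ) * m = n * (2 * d + 1) := by
    rw [hd] at hc; exact_mod_cast hc
  refine Prod.ext ?_ ?_
  · simp only [gm, dperm_apply, s0, s1, s2, s3, Prod.fst_neg]
    rw [← mul_neg]
    congr 1
    have : ((2 * Real.pi * (((j + m : ℤ) : ℝ) + x.1 3 / (x.1 2 + x.1 3)) / n : ℝ) : ℂ) * Complex.I =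
      ((2 * Real.pi * ((j : ℝ) + x.1 3 / (x.1 2 + x.1 3)) / n : ℝ) : ℂ) * Complex.I + Real.pi * Complex.I
        + d * (2 * Real.pi * Complex.I) := by
      push_cast
      have h5 : (Real.pi : ℂ) * Complex.I + d * (2 * Real.pi * Complex.I) = (2 * m) * Real.pi / n * Complex.I := by
        rw [hm]; field_simp; ring
      rw [add_assoc _ _ ((d : ℂ) * (2 * Real.pi * Complex.I)), h5]
      ring
    rw [this, Complex.exp_add, Complex.exp_add, Complex.exp_pi_mul_I, Complex.exp_int_mul_two_pi_mul_I]
    ring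
  · simp only [gm, dperm_apply, s0, s1, Prod.snd_neg]; ring

/-! #### The chart around an edge -/

def per (D : GlueingDatum 3) (f : EFlag D) : ℕ := Function.minimalPeriod (fun g => flT D • g) f

def fl (D : GlueingDatum 3) (f : EFlag D) (j : ℤ) : EFlag D := (flT D ^ j) f

lemma per_pos (D : GlueingDatum 3) (f : EFlag D) : 0 < per D f := by
  have := D.fintypeI
  apply Function.minimalPeriod_pos_of_mem_periodicPts
  exact (MulAction.injective (flT D)).mem_periodicPts f

lemma fl_add (D : GlueingDatum 3) (f : EFlag D) (a b : ℤ) : fl D f (a + b) = (flT D ^ a) (fl D f b) := by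
  rw [fl, zpow_add]; rfl

lemma fl_eq (D : GlueingDatum 3) (f : EFlag D) (j k : ℤ) : fl D f j = fl D f k ↔ (per D f : ℤ) ∣ k - j := by
  have h := MulAction.zpow_smul_eq_iff_minimalPeriod_dvd (a := flT D) (b := f) (n := k - j)
  rw [per, ← h]
  have e : fl D f k = (flT D ^ j) (fl D f (k - j)) := by rw [← fl_add]; congr 1; ring
  rw [e]
  constructor
  · intro h1
    exact ((flT D ^ j).injective h1).symm
  · intro h1
    change (flT D ^ j) f = _
    congr 1
    exact h1.symm

def hm (D : GlueingDatum 3) (f : EFlag D) (j : ℤ) (x : Delta 3) : GlueSpace D :=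
  Quot.mk (glueRel D) (iot D (fl D f j) x)

lemma hm_cont (D : GlueingDatum 3) (f : EFlag D) (j : ℤ) : Continuous (hm D f j) :=
  continuous_quot_mk.comp (iot_cont D _)

lemma hm_succ (D : GlueingDatum 3) (f : EFlag D) (j : ℤ) (x : Delta 3) (h2 : x.1 2 = 0) :
    hm D f j x = hm D f (j + 1) (dperm sw x) := by
  have : fl D f (j + 1) = flT D (fl D f j) := by rw [add_comm, fl_add, zpow_one]
  rw [hm, hm, this]
  exact Quot.sound (glueRel_two D _ x h2)

lemma hm_zero (D : GlueingDatum 3) (f : EFlag D) (j k : ℤ) (x : Delta 3) (h2 : x.1 2 = 0) (h3 : x.1 3 = 0) :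
    hm D f j x = hm D f k x := by
  have hsx : dperm sw x = x := by
    apply delta_ext <;> simp [dperm_apply, Equiv.swap_apply_def, h2, h3]
  have h1 : ∀ j, hm D f j x = hm D f (j + 1) x := by
    intro j
    have := hm_succ D f j x h2
    rwa [hsx] at this
  have h4 : ∀ j : ℤ, hm D f j x = hm D f 0 x := by
    intro j
    induction j with
    | zero => rfl
    | succ n ih => rw [← h1, ih]
    | pred n ih => rw [h1, sub_add_cancel, ih]
  rw [h4 j, h4 k]

lemma hm_period (D : GlueingDatum 3) (f : EFlag D) (j k : ℤ) (x : Delta 3) (h : (per D f : ℤ) ∣ k - j) :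
    hm D f j x = hm D f k x := by
  rw [hm, hm, (fl_eq D f j k).2 h]

lemma hm_factor (D : GlueingDatum 3) (f : EFlag D) (j k : ℤ) (x y : Delta 3)
    (h : gm (per D f) j x = gm (per D f) k y) : hm D f j x = hm D f k y := by
  rcases gm_eq _ (per_pos D f) j k x y h with ⟨rfl, h2, h3⟩ | ⟨rfl, h2⟩ | ⟨h1, rfl, h2, -⟩ | ⟨h1, rfl, h2, -⟩
  · exact hm_zero D f j k x h2 h3
  · exact hm_period D f j k x h2
  · rw [hm_succ D f j x h2]; exact hm_period D f _ _ _ h1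
  · rw [hm_succ D f k y h2]; exact (hm_period D f _ _ _ h1).symm

def vpt : Delta 3 := ⟨Pi.single 0 1, fun v => by
  by_cases h : v = 0
  · subst h; simp
  · simp [h], by simp⟩

def FF (D : GlueingDatum 3) (f : EFlag D) : ℂ × ℝ → GlueSpace D :=
  Function.extend (fun p : ℤ × Delta 3 => gm (per D f) p.1 p.2) (fun p => hm D f p.1 p.2)
    (fun _ => hm D f 0 vpt)

lemma FF_gm (D : GlueingDatum 3) (f : EFlag D) (j : ℤ) (x : Delta 3) :
    FF D f (gm (per D f) j x) = hm D f j x := by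
  have h : Function.FactorsThrough (fun p : ℤ × Delta 3 => hm D f p.1 p.2)
      (fun p : ℤ × Delta 3 => gm (per D f) p.1 p.2) := by
    rintro ⟨j, x⟩ ⟨k, y⟩ h
    exact hm_factor D f j k x y h
  exact h.extend_apply _ (j, x)

def EE : Set (ℂ × ℝ) := {u | ‖u.1‖ + |u.2| < 1}

lemma EE_open : IsOpen EE := by
  apply isOpen_lt <;> fun_prop

lemma gm_surj' (D : GlueingDatum 3) (f : EFlag D) (u : ℂ × ℝ) (hu : u ∈ EE) :
    ∃ (j : ℕ) (x : Delta 3), j < per D f ∧ gm (per D f) j x = u ∧ 0 < x.1 0 ∧ 0 < x.1 1 := by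
  obtain ⟨j, x, h⟩ := gm_surj (per D f) (per_pos D f) u hu
  have hp : (0 : ℤ) < per D f := by exact_mod_cast per_pos D f
  have h0 := Int.emod_nonneg j hp.ne'
  have h1 := Int.emod_lt_of_pos j hp
  obtain ⟨k, hk⟩ := Int.eq_ofNat_of_zero_le h0
  have h3 : gm (per D f) k x = u := by
    rw [← h]
    apply gm_period _ (per_pos D f)
    rw [← hk]
    exact Int.dvd_self_sub_emod
  refine ⟨k, x, by omega, h3, ?_⟩
  apply gm_pos (per D f) k
  rw [h3]; exact hu

instance delta_compact : CompactSpace (Delta 3) :=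
  isCompact_iff_compactSpace.1 (isCompact_stdSimplex ℝ (Fin 4))

lemma FF_cont (D : GlueingDatum 3) (f : EFlag D) : ContinuousOn (FF D f) EE := by
  rw [continuousOn_iff_isClosed]
  intro C hC
  refine ⟨⋃ j ∈ Finset.range (per D f), gm (per D f) j '' (hm D f j ⁻¹' C), ?_, ?_⟩
  · apply isClosed_biUnion_finset
    intro j _
    exact ((hC.preimage (hm_cont D f j)).isCompact.image (gm_cont _ _)).isClosed
  · ext u
    simp only [Set.mem_inter_iff, Set.mem_preimage, Set.mem_iUnion, Finset.mem_range, Set.mem_image]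
    constructor
    · rintro ⟨h1, h2⟩
      obtain ⟨j, x, hj, rfl, -⟩ := gm_surj' D f u h2
      rw [FF_gm] at h1
      exact ⟨⟨j, hj, x, h1, rfl⟩, h2⟩
    · rintro ⟨⟨j, hj, x, h1, rfl⟩, h2⟩
      rw [FF_gm]
      exact ⟨h1, h2⟩

def US (D : GlueingDatum 3) (f : EFlag D) (O : Set (ℂ × ℝ)) : Set (GlueTotal D) :=
  {p | ∃ (j : ℤ) (x : Delta 3), 0 < x.1 0 ∧ 0 < x.1 1 ∧ gm (per D f) j x ∈ O ∧ iot D (fl D f j) x = p}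

lemma US_step (D : GlueingDatum 3) (f : EFlag D) (O : Set (ℂ × ℝ)) (p q : GlueTotal D)
    (h : glueRel D p q) (hp : p ∈ US D f O) : q ∈ US D f O := by
  obtain ⟨j, x, x0, x1, hO, rfl⟩ := hp
  obtain ⟨k, h0, h1, h2⟩ := h
  have hk : x.1 ((fl D f j).2⁻¹ k) = 0 := h0
  have s0 : sw 0 = 0 := by decide
  have s1 : sw 1 = 1 := by decide
  have hc : ∀ c : Fin 4, c = 0 ∨ c = 1 ∨ c = 2 ∨ c = 3 := by decide
  rcases hc ((fl D f j).2⁻¹ k) with h | h | h | h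
  · rw [h] at hk; exact absurd hk x0.ne'
  · rw [h] at hk; exact absurd hk x1.ne'
  · have hk' : k = (fl D f j).2 2 := by rw [← h]; simp
    subst hk'
    rw [h] at hk
    have hq := glue_two D (fl D f j) x q h1 h2
    refine ⟨j + 1, dperm sw x, by rwa [dperm_apply, s0], by rwa [dperm_apply, s1], ?_, ?_⟩
    · rwa [← gm_succ _ _ _ hk]
    · rw [hq, add_comm, fl_add, zpow_one]
  · have hk' : k = (fl D f j).2 3 := by rw [← h]; simp
    subst hk'
    rw [h] at hk
    have hq := glue_three D (fl D f j) x q h1 h2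
    refine ⟨-1 + j, dperm sw x, by rwa [dperm_apply, s0], by rwa [dperm_apply, s1], ?_, ?_⟩
    · rw [gm_succ _ (-1 + j) (dperm sw x) (by simpa [dperm_apply] using hk), dperm_dperm]
      simpa [dperm_one] using hO
    · rw [hq, fl_add, zpow_neg_one]

lemma sat_of_step (D : GlueingDatum 3) (U : Set (GlueTotal D))
    (hU : ∀ p q, glueRel D p q → p ∈ U → q ∈ U) (p q : GlueTotal D)
    (h : Quot.mk (glueRel D) p = Quot.mk (glueRel D) q) : p ∈ U → q ∈ U := by
  let L : GlueSpace D → Prop := Quot.lift (fun p => p ∈ U) (fun a b hab =>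
    propext ⟨hU a b hab, hU b a (glueRel_symm D hab)⟩)
  intro hp
  have h1 : L (Quot.mk _ p) := hp
  rw [h] at h1
  exact h1

lemma US_open (D : GlueingDatum 3) (f : EFlag D) (O : Set (ℂ × ℝ)) (hO : IsOpen O) : IsOpen (US D f O) := by
  have : US D f O = ⋃ j : ℤ, iot D (fl D f j) '' {x | 0 < x.1 0 ∧ 0 < x.1 1 ∧ gm (per D f) j x ∈ O} := by
    ext p
    simp only [US, Set.mem_iUnion, Set.mem_image, Set.mem_ofPred_eq]
    constructor
    · rintro ⟨j, x, a, b, c, d⟩; exact ⟨j, x, ⟨a, b, c⟩, d⟩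
    · rintro ⟨j, x, ⟨a, b, c⟩, d⟩; exact ⟨j, x, a, b, c, d⟩
  rw [this]
  apply isOpen_iUnion
  intro j
  apply iot_openMap
  have hc : ∀ a : Fin 4, Continuous fun x : Delta 3 => x.1 a := fun a =>
    (continuous_apply a).comp continuous_subtype_val
  exact (isOpen_lt continuous_const (hc 0)).inter
    ((isOpen_lt continuous_const (hc 1)).inter (hO.preimage (gm_cont _ j)))

lemma FF_open (D : GlueingDatum 3) (f : EFlag D) (O : Set (ℂ × ℝ)) (hOE : O ⊆ EE) (hO : IsOpen O) :
    IsOpen (FF D f '' O) := by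
  have h : Quot.mk (glueRel D) ⁻¹' (FF D f '' O) = US D f O := by
    ext p
    constructor
    · rintro ⟨u, hu, hup⟩
      obtain ⟨j, x, hj, rfl, x0, x1⟩ := gm_surj' D f u (hOE hu)
      rw [FF_gm] at hup
      exact sat_of_step D _ (US_step D f O) _ _ hup ⟨j, x, x0, x1, hu, rfl⟩
    · rintro ⟨j, x, x0, x1, hO, rfl⟩
      exact ⟨_, hO, FF_gm D f j x⟩
  have h2 := US_open D f O hO
  rw [← h] at h2
  exact isQuotientMap_quot_mk.isOpen_preimage.1 h2

lemma FF_fib (D : GlueingDatum 3) (f : EFlag D) (j : ℤ) (x : Delta 3) (v : ℂ × ℝ) (hv : v ∈ EE)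
    (h : FF D f (gm (per D f) j x) = FF D f v) :
    ∃ (k : ℤ) (y : Delta 3), gm (per D f) k y = v ∧ iot D (fl D f k) y = iot D (fl D f j) x := by
  obtain ⟨k, y, hj, rfl, y0, y1⟩ := gm_surj' D f v hv
  rw [FF_gm, FF_gm] at h
  obtain ⟨k', y', _, _, h1, h2⟩ := sat_of_step D _ (US_step D f {gm (per D f) k y}) _ _ h.symm
    ⟨k, y, y0, y1, rfl, rfl⟩
  exact ⟨k', y', h1, h2⟩

lemma vert_closed (D : GlueingDatum 3) : IsClosed {p : GlueTotal D | ∃ v, p.2.1 v = 1} := by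
  have hc : ∀ v : Fin 4, Continuous fun p : GlueTotal D => p.2.1 v := by
    intro v
    rw [continuous_sigma_iff]
    intro i
    exact (continuous_apply v).comp continuous_subtype_val
  have : {p : GlueTotal D | ∃ v, p.2.1 v = 1} = ⋃ v : Fin 4, {p : GlueTotal D | p.2.1 v = 1} := by
    ext p; simp
  rw [this]
  exact isClosed_iUnion_of_finite fun v => isClosed_eq (hc v) continuous_const

lemma vert_step (D : GlueingDatum 3) (p q : GlueTotal D) (h : glueRel D p q) :
    (∃ v, p.2.1 v = 1) → (∃ v, q.2.1 v = 1) := by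
  rintro ⟨v, hv⟩
  obtain ⟨k, h0, h1, h2⟩ := h
  exact ⟨D.glue (p.1, k) v, by rw [h2]; simpa using hv⟩

lemma vert_iff (D : GlueingDatum 3) (p : GlueTotal D) :
    Quot.mk (glueRel D) p ∈ vertexImage D ↔ ∃ v, p.2.1 v = 1 := by
  constructor
  · rintro ⟨q, hq, hqp⟩
    exact sat_of_step D {p | ∃ v, p.2.1 v = 1} (vert_step D) q p hqp hq
  · intro h; exact ⟨p, h, rfl⟩

lemma star_open (D : GlueingDatum 3) : IsOpen ((vertexImage D)ᶜ) := by
  rw [isOpen_compl_iff]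
  refine isQuotientMap_quot_mk.isClosed_preimage.1 ?_
  have : Quot.mk (glueRel D) ⁻¹' (vertexImage D) = {p : GlueTotal D | ∃ v, p.2.1 v = 1} := by
    ext p; exact vert_iff D p
  rw [this]; exact vert_closed D

lemma FF_star (D : GlueingDatum 3) (f : EFlag D) (u : ℂ × ℝ) (hu : u ∈ EE) :
    FF D f u ∈ (vertexImage D)ᶜ := by
  obtain ⟨j, x, hj, rfl, x0, x1⟩ := gm_surj' D f u hu
  rw [FF_gm]
  intro h
  obtain ⟨v, hv⟩ := (vert_iff D _).1 h
  have hv' : x.1 ((fl D f j).2⁻¹ v) = 1 := hv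
  have hs := delta_sum x
  have x2 := x.2.1 2
  have x3 := x.2.1 3
  have hc : ∀ c : Fin 4, c = 0 ∨ c = 1 ∨ c = 2 ∨ c = 3 := by decide
  rcases hc ((fl D f j).2⁻¹ v) with h | h | h | h <;> rw [h] at hv' <;> linarith

lemma star_cover (D : GlueingDatum 3) (z : GlueSpace D) (hz : z ∈ (vertexImage D)ᶜ) :
    ∃ (f : EFlag D) (u : ℂ × ℝ), u ∈ EE ∧ FF D f u = z := by
  obtain ⟨⟨i, y⟩, rfl⟩ := Quot.exists_rep z
  have hz' : ¬ ∃ v, y.1 v = 1 := fun h => hz ((vert_iff D _).2 h)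
  push Not at hz'
  have hpos : ∃ a b : Fin 4, a ≠ b ∧ 0 < y.1 a ∧ 0 < y.1 b := by
    have h1 : ∃ a, 0 < y.1 a := by
      by_contra hcon
      push Not at hcon
      have := delta_sum y
      linarith [hcon 0, hcon 1, hcon 2, hcon 3]
    obtain ⟨a, ha⟩ := h1
    by_contra hcon
    push Not at hcon
    apply hz' a
    have h2 : ∀ b, b ≠ a → y.1 b = 0 := fun b hb => le_antisymm (hcon a b hb.symm ha) (y.2.1 b)
    exact (Finset.sum_eq_single a (fun b _ hb => h2 b hb) (by simp)).symm.trans y.2.2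
  obtain ⟨a, b, hab, ha, hb⟩ := hpos
  obtain ⟨σ, h0, h1⟩ := exists_flag i a b hab
  refine ⟨(i, σ), gm (per D (i, σ)) 0 (dperm σ y), ?_, ?_⟩
  · change ‖_‖ + |_| < 1
    rw [gm_norm]
    have hs := delta_sum (dperm σ y)
    have e0 : 0 < (dperm σ y).1 0 := by rw [dperm_apply, h0]; exact ha
    have e1 : 0 < (dperm σ y).1 1 := by rw [dperm_apply, h1]; exact hb
    have e2 : |(gm (per D (i, σ)) 0 (dperm σ y)).2| < (dperm σ y).1 0 + (dperm σ y).1 1 := by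
      rw [abs_lt]
      simp only [gm]
      constructor <;> linarith
    linarith
  · rw [FF_gm, hm]
    congr 1
    simp [fl, iot, dperm_dperm, dperm_one]

/-! #### Conclusion -/

lemma perm_four (τ : Equiv.Perm (Fin 4)) :
    (τ = 1 ∨ τ = sw ∨ τ = sw' ∨ τ = sw * sw') ∨
    ∃ a c, (a = 0 ∨ a = 1) ∧ (c = 2 ∨ c = 3) ∧ (τ a = 2 ∨ τ a = 3) ∧ (τ c = 0 ∨ τ c = 1) := by
  revert τ; decide

lemma perm_lemma (τ : Equiv.Perm (Fin 4)) (x : Delta 3)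
    (hx : x.1 2 + x.1 3 < x.1 0 ∧ x.1 2 + x.1 3 < x.1 1)
    (hy : (dperm τ x).1 2 + (dperm τ x).1 3 < (dperm τ x).1 0 ∧
      (dperm τ x).1 2 + (dperm τ x).1 3 < (dperm τ x).1 1) :
    τ = 1 ∨ τ = sw ∨ τ = sw' ∨ τ = sw * sw' := by
  rcases perm_four τ with h | ⟨a, c, ha, hc, hta, htc⟩
  · exact h
  exfalso
  have x2 := x.2.1 2
  have x3 := x.2.1 3
  have y2 := (dperm τ x).2.1 2
  have y3 := (dperm τ x).2.1 3
  obtain ⟨hx0, hx1⟩ := hx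
  obtain ⟨hy0, hy1⟩ := hy
  have h1 : (dperm τ x).1 c < (dperm τ x).1 a := by
    rcases ha with rfl | rfl <;> rcases hc with rfl | rfl <;> linarith
  have h2 : x.1 (τ a) < x.1 (τ c) := by
    rcases hta with h | h <;> rcases htc with h' | h' <;> rw [h, h'] <;> linarith
  rw [dperm_apply, dperm_apply] at h1
  linarith

lemma flag_cases (D : GlueingDatum 3) (f : EFlag D) (j k : ℤ) (x y : Delta 3)
    (hx : x.1 2 + x.1 3 < x.1 0 ∧ x.1 2 + x.1 3 < x.1 1)
    (hy : y.1 2 + y.1 3 < y.1 0 ∧ y.1 2 + y.1 3 < y.1 1)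
    (h : iot D (fl D f j) x = iot D (fl D f k) y) :
    (fl D f k = fl D f j ∧ y = x) ∨ (fl D f k = flS D (fl D f j) ∧ y = dperm sw' x) := by
  obtain ⟨τ, h1, rfl⟩ := iot_eq D _ _ _ _ h
  have e : fl D f k = (flT D ^ (k - j)) (fl D f j) := by rw [← fl_add]; congr 1; ring
  rcases perm_lemma τ x hx hy with rfl | rfl | rfl | rfl
  · left
    rw [mul_one] at h1
    exact ⟨h1, dperm_one x⟩
  · exact absurd (e.symm.trans h1) (flR_orbit D _ _)
  · right; exact ⟨h1, rfl⟩
  · refine absurd (e.symm.trans h1) ?_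
    have := flSR_orbit D (k - j) (fl D f j)
    rwa [Equiv.Perm.mul_apply, flS_apply, flR_apply, mul_assoc] at this

lemma no_self_face (D : GlueingDatum 3) (f : EFlag D) (j k : ℤ) (x : Delta 3)
    (h0 : 0 < x.1 0) (h1 : 0 < x.1 1) (h2 : x.1 2 = 0) (h3 : 0 < x.1 3)
    (hjk : (per D f : ℤ) ∣ k - (j + 1))
    (h : iot D (fl D f j) x = iot D (fl D f k) (dperm sw x)) : False := by
  rw [← (fl_eq D f _ _).2 hjk, add_comm, fl_add, zpow_one] at h
  set g := fl D f j
  apply D.P_fixedPointFree (g.1, g.2 2)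
  obtain ⟨τ, e1, e2⟩ := iot_eq D _ _ _ _ h
  have h4 := D.glue_face (g.1, g.2 2)
  rw [flT_apply] at e1
  have e3 := congrArg Prod.fst e1
  have e4 := congrArg Prod.snd e1
  simp only at e3 e4 h4
  have h5 : x.1 (τ 3) = 0 := by
    have := congrArg (fun w : Delta 3 => w.1 3) e2
    simp only [dperm_apply] at this
    rw [← this]; simpa using h2
  have h6 : τ 3 = 2 := by
    have hc : ∀ c : Fin 4, c = 0 ∨ c = 1 ∨ c = 2 ∨ c = 3 := by decide
    rcases hc (τ 3) with h | h | h | h <;> rw [h] at h5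
    · linarith
    · linarith
    · exact h
    · linarith
  have h7 := congrArg (fun s : Equiv.Perm (Fin 4) => s 3) e4
  simp only [Equiv.Perm.mul_apply, h6, Equiv.swap_apply_right] at h7
  exact Prod.ext e3 (h4.symm.trans h7)

lemma FF_locInj (D : GlueingDatum 3) (hD : NoRev D) (f : EFlag D) (u : ℂ × ℝ) (hu : u ∈ EE) :
    ∃ N : Set (ℂ × ℝ), IsOpen N ∧ u ∈ N ∧ N ⊆ EE ∧ Set.InjOn (FF D f) N := by
  let n := per D f
  let Z : ℕ → ℕ → Set (Delta 3 × Delta 3) := fun j k =>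
    {p | j ≠ k ∧ iot D (fl D f j) p.1 = iot D (fl D f k) p.2}
  let K : Set ((ℂ × ℝ) × (ℂ × ℝ)) := ⋃ j ∈ Finset.range n, ⋃ k ∈ Finset.range n,
    (fun p : Delta 3 × Delta 3 => (gm n j p.1, gm n k p.2)) '' Z j k
  have hK : IsClosed K := by
    apply isClosed_biUnion_finset
    intro j _
    apply isClosed_biUnion_finset
    intro k _
    have hZ : IsClosed (Z j k) := by
      by_cases hjk : j = k
      · have : Z j k = ∅ := by ext p; simp [Z, hjk]
        rw [this]; exact isClosed_empty
      · have : Z j k = {p | iot D (fl D f j) p.1 = iot D (fl D f k) p.2} := by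
          ext p; simp [Z, hjk]
        rw [this]
        exact isClosed_eq ((iot_cont D _).comp continuous_fst) ((iot_cont D _).comp continuous_snd)
    refine (hZ.isCompact.image ?_).isClosed
    exact ((gm_cont n j).comp continuous_fst).prodMk ((gm_cont n k).comp continuous_snd)
  have hnot : (u, u) ∉ K := by
    intro hmem
    simp only [K, Set.mem_iUnion, Finset.mem_range, Set.mem_image] at hmem
    obtain ⟨j, hj, k, hk, ⟨x, y⟩, ⟨hjk, hxy⟩, he⟩ := hmem
    simp only at hxy
    have e1 : gm n j x = u := congrArg Prod.fst he
    have e2 : gm n k y = u := congrArg Prod.snd he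
    obtain ⟨x0, x1⟩ := gm_pos n j x (by rw [e1]; exact hu)
    obtain ⟨y0, y1⟩ := gm_pos n k y (by rw [e2]; exact hu)
    have hdvd : ¬ (n : ℤ) ∣ (k : ℤ) - j := by
      intro hd
      have := Int.eq_zero_of_abs_lt_dvd hd (by rw [abs_lt]; constructor <;> omega)
      omega
    rcases gm_eq n (per_pos D f) j k x y (e1.trans e2.symm) with ⟨rfl, h2, h3⟩ | ⟨rfl, h2⟩ | ⟨h1, rfl, h2, h3⟩ | ⟨h1, rfl, h2, h3⟩
    · have hx : x.1 2 + x.1 3 < x.1 0 ∧ x.1 2 + x.1 3 < x.1 1 := by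
        rw [h2, h3]; constructor <;> linarith
      rcases flag_cases D f j k x x hx hx hxy with ⟨h, -⟩ | ⟨h, -⟩
      · exact hdvd ((fl_eq D f _ _).1 h.symm)
      · apply hD (fl D f j) (k - j)
        rw [← h, ← fl_add]; congr 1; ring
    · exact hdvd h2
    · exact no_self_face D f j k x x0 x1 h2 h3 h1 hxy
    · exact no_self_face D f k j y y0 y1 h2 h3 h1 hxy.symm
  have hnhds : Kᶜ ∩ EE ×ˢ EE ∈ 𝓝 (u, u) :=
    (hK.isOpen_compl.inter (EE_open.prod EE_open)).mem_nhds ⟨hnot, hu, hu⟩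
  rw [nhds_prod_eq, Filter.mem_prod_same_iff] at hnhds
  obtain ⟨t, ht, hts⟩ := hnhds
  obtain ⟨N, hNt, hN, huN⟩ := mem_nhds_iff.1 ht
  refine ⟨N, hN, huN, ?_, ?_⟩
  · intro v hv
    exact (hts (⟨hNt hv, hNt hv⟩ : (v, v) ∈ t ×ˢ t)).2.1
  · intro v hv w hw hvw
    have hvE : v ∈ EE := (hts (⟨hNt hv, hNt hv⟩ : (v, v) ∈ t ×ˢ t)).2.1
    have hwE : w ∈ EE := (hts (⟨hNt hw, hNt hw⟩ : (w, w) ∈ t ×ˢ t)).2.1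
    have hvwK : (v, w) ∉ K := (hts (⟨hNt hv, hNt hw⟩ : (v, w) ∈ t ×ˢ t)).1
    obtain ⟨j, x, hj, rfl, -⟩ := gm_surj' D f v hvE
    obtain ⟨k, y, hk, hiot⟩ := FF_fib D f j x w hwE hvw
    have hp : (0 : ℤ) < per D f := by exact_mod_cast per_pos D f
    obtain ⟨l, hl⟩ := Int.eq_ofNat_of_zero_le (Int.emod_nonneg k hp.ne')
    have hll := Int.emod_lt_of_pos k hp
    have hd : (per D f : ℤ) ∣ k - l := by
      rw [← hl]
      exact Int.dvd_self_sub_emod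
    have h1 : gm (per D f) l y = w := by
      rw [← hk]; exact gm_period _ (per_pos D f) _ _ _ hd
    rw [← (fl_eq D f _ _).2 hd] at hiot
    by_cases hjl : j = l
    · subst hjl
      have := iot_inj D _ hiot
      rw [← h1, this]
    · exfalso
      apply hvwK
      simp only [K, Set.mem_iUnion, Finset.mem_range, Set.mem_image]
      exact ⟨j, hj, l, by omega, (x, y), ⟨hjl, hiot.symm⟩, by rw [← h1]⟩

lemma finrank_CR : Module.finrank ℝ (ℂ × ℝ) = 3 := by
  rw [Module.finrank_prod, Complex.finrank_real_complex, Module.finrank_self]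

lemma manifold_of_noRev (D : GlueingDatum 3) (hD : NoRev D) : LocEuclidean 3 (GlueSpaceStar D) := by
  rw [locEuclidean_open_iff _ (star_open D)]
  intro z hz
  obtain ⟨f, u, hu, rfl⟩ := star_cover D z hz
  obtain ⟨N, hN, huN, hNE, hinj⟩ := FF_locInj D hD f u hu
  obtain ⟨g, hg, h1, h2⟩ := euclid_of_inj finrank_CR N hN u huN (FF D f) ((FF_cont D f).mono hNE)
    (fun O hO hO' => FF_open D f O (hO.trans hNE) hO') hinj
  refine ⟨g, hg, h1, h2.trans ?_⟩
  rintro _ ⟨v, hv, rfl⟩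
  exact FF_star D f v (hNE hv)

def BB : Set (ℂ × ℝ) := {u | 3 * ‖u.1‖ + |u.2| < 1}

lemma BB_sub : BB ⊆ EE := by
  intro u hu
  have hu : 3 * ‖u.1‖ + |u.2| < 1 := hu
  have := norm_nonneg u.1
  change ‖u.1‖ + |u.2| < 1
  linarith

lemma noRev_of_manifold (D : GlueingDatum 3) (hD : LocEuclidean 3 (GlueSpaceStar D)) : NoRev D := by
  intro f m hm'
  rw [locEuclidean_open_iff _ (star_open D)] at hD
  have hBo : IsOpen BB := by apply isOpen_lt <;> fun_prop
  have h0B : (0 : ℂ × ℝ) ∈ BB := by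
    change 3 * ‖(0 : ℂ)‖ + |(0 : ℝ)| < 1
    simp
  obtain ⟨g, hg, hg0, -⟩ := hD (FF D f 0) (FF_star D f 0 (BB_sub h0B))
  have hrk : 1 < Module.rank ℝ (ℂ × ℝ) := by
    rw [← Module.finrank_eq_rank, finrank_CR]; norm_num
  have hST : ∀ j : ℤ, (flS D) ((flT D ^ j) f) = (flT D ^ j) (flS D f) := by
    intro j
    have : Commute (flS D) (flT D) := flST D
    have h := (this.zpow_right j).eq
    rw [← Equiv.Perm.mul_apply, h, Equiv.Perm.mul_apply]
  have hfS : ∀ j : ℤ, fl D f (j + m) = flS D (fl D f j) := by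
    intro j
    rw [fl_add, fl, hm', fl, hST]
  have hn1 : ¬ (per D f : ℤ) ∣ m := by
    intro h
    have := (fl_eq D f 0 m).2 (by simpa using h)
    have h2 := hfS 0
    rw [zero_add, ← this] at h2
    exact flS_ne D _ h2.symm
  have hn2 : (per D f : ℤ) ∣ 2 * m := by
    have h2 := hfS m
    have h3 := hfS 0
    rw [zero_add] at h3
    rw [h3, ← Equiv.Perm.mul_apply, flS_sq, Equiv.Perm.one_apply] at h2
    have := (fl_eq D f 0 (m + m)).1 h2.symm
    rw [two_mul]; simpa using this
  refine no_euclid hrk BB hBo h0B ?_ (FF D f) ((FF_cont D f).mono BB_sub)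
    (fun O hO hO' => FF_open D f O (hO.trans BB_sub) hO') ?_ g hg hg0
  · intro u hu
    have hu : 3 * ‖u.1‖ + |u.2| < 1 := hu
    change 3 * ‖(-u).1‖ + |(-u).2| < 1
    simpa using hu
  · intro u hu v hv
    obtain ⟨j, x, hj, rfl, x0, x1⟩ := gm_surj' D f u (BB_sub hu)
    constructor
    · intro h
      obtain ⟨k, y, rfl, hiot⟩ := FF_fib D f j x v (BB_sub hv) h
      rcases flag_cases D f j k x y (gm_pos3 _ _ _ hu) (gm_pos3 _ _ _ hv) hiot.symm with ⟨h1, rfl⟩ | ⟨h1, rfl⟩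
      · left
        exact gm_period _ (per_pos D f) _ _ _ ((fl_eq D f _ _).1 h1.symm)
      · right
        rw [← hfS] at h1
        rw [gm_period _ (per_pos D f) _ _ _ ((fl_eq D f _ _).1 h1), gm_neg _ (per_pos D f) _ _ _ hn2 hn1, neg_neg]
    · rintro (h | h)
      · rw [h]
      · have hv' : v = gm (per D f) (j + m) (dperm sw' x) := by
          rw [gm_neg _ (per_pos D f) _ _ _ hn2 hn1, h, neg_neg]
        rw [hv', FF_gm, FF_gm, hm, hm, hfS]
        congr 1
        exact (iot_perm D (fl D f j) sw' x).symm

/-- Proposition: in dimension 3, the complement `X*` of the vertices in the glued space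
is an (open) 3-manifold if and only if condition Dir holds. -/
theorem dim3_star_manifold_iff_dir (D : GlueingDatum 3) :
    LocEuclidean 3 (GlueSpaceStar D) ↔ Dir D := by
  exact ⟨fun h => dir_of_noRev D (noRev_of_manifold D h), fun h => manifold_of_noRev D (noRev_of_dir D h)⟩
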